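/- arXiv:0803.3781 — 8 statements merged into one kernel-verified Lean document; each statement's English description precedes it below -/
import Mathlib

section
/- Let L = GF(2^n), let s be a positive integer with gcd(s,n) = 1, and let f(x) = Σ_{i=0}^{d} r_i x^{2^{si}} with coefficients r_0, …, r_d ∈ L, not all zero. Then f has at most 2^d zeroes in L. -/
open Finset in
/-- Summation by parts for a product of two sequences. -/
lemma sum_partialSums_mul_sub {R : Type*} [CommRing R] (g u : ℕ → R) (d : ℕ) :
    ∑ i ∈ range d, (∑ j ∈ range (i + 1), g j) * (u i - u (i + 1)) =
      ∑ i ∈ range (d + 1), g i * u i - (∑ j ∈ range (d + 1), g j) * u d := by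
  induction d with
  | zero => simp
  | succ d ih =>
    rw [sum_range_succ, ih, sum_range_succ _ (d + 1), sum_range_succ _ (d + 1)]
    ring

open Finset in
/-- A nonzero skew polynomial of degree at most `d` in an endomorphism `σ` whose only fixed points
are `0` and `1` has at most `2 ^ d` zeros. -/
lemma card_zeros_skewPolynomial_le {L : Type*} [Field L] [Fintype L] [DecidableEq L]
    (σ : L →+* L) (hσ : ∀ x, σ x = x → x = 0 ∨ x = 1) (d : ℕ) (r : ℕ → L)
    (hr : ∃ i ≤ d, r i ≠ 0) :
    #{x : L | ∑ i ∈ range (d + 1), r i * σ^[i] x = 0} ≤ 2 ^ d := by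
  induction d generalizing r with
  | zero =>
    obtain ⟨i, hi, hri⟩ := hr
    obtain rfl : i = 0 := by omega
    simp [hri, filter_eq']
  | succ d ih =>
    by_cases hroot : ∃ a : L, a ≠ 0 ∧ ∑ i ∈ range (d + 1 + 1), r i * σ^[i] a = 0
    · obtain ⟨a, ha, hra⟩ := hroot
      have hσa (i : ℕ) : σ^[i] a ≠ 0 := by
        rw [← RingHom.coe_pow]
        exact (map_ne_zero _).2 ha
      set g : ℕ → L := fun i => r i * σ^[i] a with hg
      set h : ℕ → L := fun i => ∑ j ∈ range (i + 1), g j with hh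
      have hlast : h (d + 1) = 0 := hra
      have hne : ∃ i ≤ d, h i ≠ 0 := by
        by_contra! hz
        obtain ⟨i, hi, hri⟩ := hr
        have hz' : ∀ k ≤ d + 1, h k = 0 := fun k hk => by
          rcases Nat.lt_or_ge d k with hk' | hk'
          · rwa [show k = d + 1 by omega]
          · exact hz k hk'
        have hgi : g i = 0 := by
          have h1 := hz' i hi
          cases i with
          | zero => simpa [hh] using h1
          | succ i =>
            have h2 := hz' i (by omega)
            simp only [hh] at h1 h2
            rwa [sum_range_succ, h2, zero_add] at h1
        exact mul_ne_zero hri (hσa i) hgi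
      have hmaps : ∀ x ∈ ({x : L | ∑ i ∈ range (d + 1 + 1), r i * σ^[i] x = 0} : Finset L),
          x / a - σ (x / a) ∈ ({x : L | ∑ i ∈ range (d + 1), h i * σ^[i] x = 0} : Finset L) := by
        intro x hx
        rw [mem_filter_univ] at hx ⊢
        have hsum := sum_partialSums_mul_sub g (fun i => σ^[i] (x / a)) (d + 1)
        have hgx : ∑ i ∈ range (d + 1 + 1), g i * σ^[i] (x / a) = 0 := by
          rw [← hx]
          refine sum_congr rfl fun i _ => ?_
          rw [hg, mul_assoc, ← iterate_map_mul, mul_div_cancel₀ _ ha]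
        rw [hgx, show ∑ j ∈ range (d + 1 + 1), g j = 0 from hlast, zero_mul, sub_zero] at hsum
        rw [← hsum]
        refine sum_congr rfl fun i _ => ?_
        rw [iterate_map_sub, ← Function.iterate_succ_apply]
      have hfib : ∀ z ∈ ({x : L | ∑ i ∈ range (d + 1), h i * σ^[i] x = 0} : Finset L),
          #{x ∈ ({x : L | ∑ i ∈ range (d + 1 + 1), r i * σ^[i] x = 0} : Finset L) |
            x / a - σ (x / a) = z} ≤ 2 := by
        intro z _
        rcases eq_empty_or_nonempty ({x ∈ ({x : L | ∑ i ∈ range (d + 1 + 1),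
          r i * σ^[i] x = 0} : Finset L) | x / a - σ (x / a) = z}) with he | ⟨w, hw⟩
        · rw [he, card_empty]
          exact Nat.zero_le 2
        · refine (card_le_card (t := {w, w + a}) fun x hx => ?_).trans card_le_two
          have h1 := (mem_filter.1 hx).2
          have h2 := (mem_filter.1 hw).2
          have hfix : σ (x / a - w / a) = x / a - w / a := by
            rw [map_sub]
            linear_combination h2 - h1
          rw [mem_insert, mem_singleton]
          refine (hσ _ hfix).imp (fun h0 => ?_) fun h0 => ?_
          · field_simp at h0
            linear_combination h0
          · field_simp at h0
            linear_combination h0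
      calc _ ≤ 2 * #{x : L | ∑ i ∈ range (d + 1), h i * σ^[i] x = 0} :=
            card_le_mul_card_image_of_maps_to hmaps 2 hfib
        _ ≤ 2 * 2 ^ d := Nat.mul_le_mul_left 2 (ih h hne)
        _ = 2 ^ (d + 1) := by ring
    · push Not at hroot
      refine (card_le_card (t := {0}) fun x hx => ?_).trans ?_
      · rw [mem_singleton]
        by_contra hx0
        exact hroot x hx0 (by simpa using hx)
      · simpa using Nat.one_le_two_pow

/-- In a field with `2 ^ n` elements, the fixed points of `x ↦ x ^ (2 ^ s)` with `s` coprime to `n`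
are `0` and `1`. -/
lemma eq_zero_or_one_of_pow_two_pow_eq {L : Type*} [Field L] [Fintype L] {n s : ℕ}
    (hgcd : Nat.gcd s n = 1) (hcard : Fintype.card L = 2 ^ n) {x : L} (hx : x ^ 2 ^ s = x) :
    x = 0 ∨ x = 1 := by
  have hs' : Function.IsPeriodicPt (fun y : L => y ^ 2) s x := by
    rw [Function.IsPeriodicPt, Function.IsFixedPt, pow_iterate]
    exact hx
  have hn' : Function.IsPeriodicPt (fun y : L => y ^ 2) n x := by
    rw [Function.IsPeriodicPt, Function.IsFixedPt, pow_iterate]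
    simpa [hcard] using FiniteField.pow_card x
  have h1 := hs'.gcd hn'
  rw [hgcd] at h1
  have h2 : x ^ 2 = x := h1
  have h3 : x * (x - 1) = 0 := by linear_combination h2
  exact (mul_eq_zero.1 h3).imp_right sub_eq_zero.1


/-- Let `L = GF(2^n)`, let `s` be a positive integer with `gcd(s, n) = 1`, and let
`f(x) = ∑_{i=0}^{d} r_i x^{2^{s i}}` with coefficients `r_0, …, r_d ∈ L`, not all
zero.  Then `f` has at most `2^d` zeroes in `L`. -/
theorem stmt1 (n s d : ℕ) (hs : 0 < s) (hgcd : Nat.gcd s n = 1)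
    (L : Type*) [Field L] [Fintype L] (hcard : Fintype.card L = 2 ^ n)
    (r : Fin (d + 1) → L) (hr : ∃ i, r i ≠ 0) :
    {x : L | ∑ i : Fin (d + 1), r i * x ^ (2 ^ (s * (i : ℕ))) = 0}.ncard ≤ 2 ^ d := by
  classical
  have hn : n ≠ 0 := by
    rintro rfl
    exact absurd hcard (by simpa using Fintype.one_lt_card (α := L).ne')
  have : CharP L 2 := by
    obtain ⟨p, hp⟩ := CharP.exists L
    have hpp : p.Prime := CharP.char_is_prime L p
    have hdvd : p ∣ 2 ^ n := by
      rw [← CharP.cast_eq_zero_iff L p, ← hcard, FiniteField.cast_card_eq_zero]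
    rwa [← (Nat.prime_dvd_prime_iff_eq hpp Nat.prime_two).1 (hpp.dvd_of_dvd_pow hdvd)]
  obtain ⟨i, hi⟩ := hr
  have key := card_zeros_skewPolynomial_le (iterateFrobenius L 2 s)
    (fun x hx => eq_zero_or_one_of_pow_two_pow_eq hgcd hcard hx) d
    (fun i => if h : i < d + 1 then r ⟨i, h⟩ else 0) ⟨i, by omega, by simpa [i.is_le] using hi⟩
  rw [← Set.ncard_coe_finset] at key
  convert key using 2
  ext x
  have hiter (k : ℕ) : (iterateFrobenius L 2 s)^[k] x = x ^ 2 ^ (s * k) := by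
    rw [← coe_iterateFrobenius_mul, iterateFrobenius_def]
  simp [hiter, Finset.sum_range, Fin.is_le]
end

section
/- Let f be the binomial of Family (1) on L = GF(2^{3k}). Then for every a ∈ L and every b ∈ L*, the Fourier transform value f^W(a,b) lies in {0, +2^{(n+1)/2}, −2^{(n+1)/2}} when n = 3k is odd, and lies in {0, ±2^{n/2}, ±2^{(n+2)/2}} when n = 3k is even. -/
theorem linearized_roots_ratio_fixed {L : Type*} [Field L] (σ θ : L →+* L)
    (hc : ∀ x, θ (σ x) = σ (θ x)) (hθ : ∀ x, θ (θ (θ x)) = x) (l : L → ZMod 7)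
    (hl : ∀ x y, x ≠ 0 → y ≠ 0 → l (x * y) = l x + l y) (q : ZMod 7) (hq : q = 2 ∨ q = 4)
    (hσl : ∀ x, x ≠ 0 → l (σ x) = q * l x) (hθl : ∀ x, x ≠ 0 → l (θ x) = q * l x)
    (r B : L) (hr : r ≠ 0) (hB : B ≠ 0) (hlr : l r ≠ 0) (u v : L) (hv : v ≠ 0)
    (hEu : σ r * (σ B * σ (σ u) - σ (θ (θ B)) * σ (σ (θ u))) =
      B * r * u - θ B * θ (θ r) * θ (θ u))
    (hEv : σ r * (σ B * σ (σ v) - σ (θ (θ B)) * σ (σ (θ v))) =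
      B * r * v - θ B * θ (θ r) * θ (θ v)) :
    σ (σ (u / v)) = u / v := by
  have hσ0 : ∀ x, x ≠ 0 → σ x ≠ 0 := fun x hx => (map_ne_zero σ).2 hx
  have hθ0 : ∀ x, x ≠ 0 → θ x ≠ 0 := fun x hx => (map_ne_zero θ).2 hx
  obtain ⟨G, hG⟩ : ∃ G, G = σ B * σ r * θ (θ B) - σ (θ B) * σ (θ (θ r)) * θ B := ⟨_, rfl⟩
  have hG0 : G ≠ 0 := by
    intro h
    rw [hG, sub_eq_zero] at h
    have h' := congrArg l h
    simp only [hl, hσl, hθl, hσ0, hθ0, hr, hB, ne_eq, not_false_eq_true, mul_eq_zero, or_self,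
      map_eq_zero] at h'
    revert h' hlr
    generalize l r = ρ
    generalize l B = β
    rcases hq with rfl | rfl <;> revert ρ β <;> decide
  have hG1 : θ G = σ (θ B) * σ (θ r) * B - σ (θ (θ B)) * σ r * θ (θ B) := by
    simp only [hG, map_sub, map_mul, hc, hθ]
  have hG2 : θ (θ G) = σ (θ (θ B)) * σ (θ (θ r)) * θ B - σ B * σ (θ r) * B := by
    simp only [hG1, map_sub, map_mul, hc, hθ]
  have rel : ∀ w, σ r * (σ B * σ (σ w) - σ (θ (θ B)) * σ (σ (θ w))) =
      B * r * w - θ B * θ (θ r) * θ (θ w) →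
      G * σ (σ w) + θ G * σ (σ (θ w)) + θ (θ G) * σ (σ (θ (θ w))) = 0 ∧
      r * σ (θ (θ r)) * θ G * w + θ r * σ r * θ (θ G) * θ w +
        θ (θ r) * σ (θ r) * G * θ (θ w) = 0 := by
    intro w h0
    have h1 := congrArg θ h0
    simp only [map_sub, map_mul, hc, hθ] at h1
    have h2 := congrArg θ h1
    simp only [map_sub, map_mul, hc, hθ] at h2
    constructor
    · rw [hG2, hG1, hG]
      linear_combination θ (θ B) * h0 + B * h1 + θ B * h2
    · rw [hG2, hG1, hG]
      linear_combination -(σ (θ B) * σ (θ r) * σ (θ (θ r))) * h0 -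
        (σ (θ (θ B)) * σ r * σ (θ (θ r))) * h1 - (σ B * σ r * σ (θ r)) * h2
  obtain ⟨u1, u2⟩ := rel u hEu
  obtain ⟨v1, v2⟩ := rel v hEv
  replace u2 := congrArg (fun x => σ (σ x)) u2
  replace v2 := congrArg (fun x => σ (σ x)) v2
  simp only [map_add, map_mul, map_zero] at u2 v2
  have hn : σ (σ (θ r * σ r * θ (θ G))) * θ (θ G) - σ (σ (θ (θ r) * σ (θ r) * G)) * θ G ≠ 0 := by
    intro h
    rw [sub_eq_zero] at h
    have h' := congrArg l h
    simp only [hl, hσl, hθl, hσ0, hθ0, hr, hG0, ne_eq, not_false_eq_true, mul_eq_zero, or_self,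
      map_eq_zero] at h'
    revert h' hlr
    generalize l r = ρ
    generalize l G = β
    rcases hq with rfl | rfl <;> revert ρ β <;> decide
  simp only [map_mul] at hn
  have key : σ (σ (θ u)) * σ (σ v) = σ (σ u) * σ (σ (θ v)) := by
    apply mul_left_cancel₀ hn
    grind
  have hy : θ (u / v) = u / v := by
    rw [← map_mul, ← map_mul, ← map_mul, ← map_mul] at key
    have := σ.injective (σ.injective key)
    rw [map_div₀, div_eq_div_iff (hθ0 v hv) hv, this]
  obtain ⟨y, hyd⟩ : ∃ y, y = u / v := ⟨_, rfl⟩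
  rw [← hyd] at hy ⊢
  have hu : u = y * v := by rw [hyd]; field_simp
  have hP : σ r * (σ B * σ (σ v) - σ (θ (θ B)) * σ (σ (θ v))) ≠ 0 := by
    intro h
    rw [h] at hEv
    have e1 := (mul_eq_zero.1 h).resolve_left (hσ0 r hr)
    rw [sub_eq_zero] at e1
    have e2 := sub_eq_zero.1 hEv.symm
    have e1 := congrArg l e1
    have e2 := congrArg l e2
    simp only [hl, hσl, hθl, hσ0, hθ0, hr, hB, hv, ne_eq, not_false_eq_true, mul_eq_zero, or_self,
      map_eq_zero] at e1 e2
    revert e1 e2 hlr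
    generalize l r = ρ
    generalize l B = β
    generalize l v = ν
    rcases hq with rfl | rfl <;> revert ρ β ν <;> decide
  apply mul_right_cancel₀ hP
  rw [hu] at hEu
  simp only [map_mul, hy] at hEu
  linear_combination hEu - y * hEv

theorem neg_one_pow_val_add (a b : ZMod 2) :
    (-1 : ℤ) ^ (a + b).val = (-1) ^ a.val * (-1) ^ b.val := by
  revert a b; decide

theorem sum_neg_one_pow_hom {G : Type*} [AddGroup G] [Fintype G] (φ : G → ZMod 2)
    (hφ : ∀ x y, φ (x + y) = φ x + φ y) :
    ∑ x : G, (-1 : ℤ) ^ (φ x).val = if ∀ x, φ x = 0 then (Fintype.card G : ℤ) else 0 := by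
  split_ifs with h
  · simp [h]
  · push Not at h
    obtain ⟨g, hg⟩ := h
    have hg1 : φ g = 1 := by
      revert hg; generalize φ g = z; revert z; decide
    have h1 : ∑ x : G, (-1 : ℤ) ^ (φ (g + x)).val = ∑ x : G, (-1 : ℤ) ^ (φ x).val :=
      Equiv.sum_comp (Equiv.addLeft g) (fun x => (-1 : ℤ) ^ (φ x).val)
    simp only [hφ g, neg_one_pow_val_add, hg1, ← Finset.mul_sum] at h1
    have : (-1 : ℤ) ^ (1 : ZMod 2).val = -1 := by decide
    rw [this] at h1
    linarith

theorem quadratic_sum_sq {G : Type*} [AddCommGroup G] [Fintype G] (Q : G → ZMod 2)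
    (D : G → G → ZMod 2) (hQ : ∀ x u, Q (x + u) = Q x + Q u + D x u)
    (hD : ∀ x y u, D (x + y) u = D x u + D y u) (V : AddSubgroup G)
    (hV : ∀ u, u ∈ V ↔ ∀ x, D x u = 0) :
    (∑ x : G, (-1 : ℤ) ^ (Q x).val) ^ 2 = 0 ∨
      (∑ x : G, (-1 : ℤ) ^ (Q x).val) ^ 2 = Fintype.card G * Nat.card V := by
  classical
  have e : (∑ x : G, (-1 : ℤ) ^ (Q x).val) ^ 2 =
      Fintype.card G * ∑ u : V, (-1 : ℤ) ^ (Q u).val := by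
    calc (∑ x : G, (-1 : ℤ) ^ (Q x).val) ^ 2
        = ∑ x : G, ∑ u : G, (-1 : ℤ) ^ (Q x).val * (-1) ^ (Q (x + u)).val := by
          rw [sq, Finset.sum_mul_sum]
          refine Finset.sum_congr rfl fun x _ => ?_
          exact (Equiv.sum_comp (Equiv.addLeft x)
            (fun y => (-1 : ℤ) ^ (Q x).val * (-1) ^ (Q y).val)).symm
      _ = ∑ u : G, (-1 : ℤ) ^ (Q u).val * ∑ x : G, (-1 : ℤ) ^ (D x u).val := by
          rw [Finset.sum_comm]
          refine Finset.sum_congr rfl fun u _ => ?_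
          rw [Finset.mul_sum]
          refine Finset.sum_congr rfl fun x _ => ?_
          rw [hQ]
          generalize Q x = a, Q u = b, D x u = c
          revert a b c; decide
      _ = ∑ u : G, if u ∈ V then Fintype.card G * (-1 : ℤ) ^ (Q u).val else 0 := by
          refine Finset.sum_congr rfl fun u _ => ?_
          rw [sum_neg_one_pow_hom (fun x => D x u) (fun x y => hD x y u)]
          simp only [hV]
          split_ifs <;> ring
      _ = _ := by
          rw [← Finset.sum_filter, Finset.mul_sum]
          exact Finset.sum_subtype _ (by simp) _
  rw [e, sum_neg_one_pow_hom (fun u : V => Q u)]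
  · split_ifs
    · right; rw [Nat.card_eq_fintype_card]
    · left; simp
  · intro x y
    rw [AddSubgroup.coe_add, hQ, (hV _).1 y.2, add_zero]

theorem card_le_four {L : Type*} [Field L] [Finite L] [CharP L 2] (s n : ℕ)
    (hs : Nat.gcd s n = 1) (hL : Nat.card L = 2 ^ n) (V : AddSubgroup L)
    (hV : ∀ u ∈ V, ∀ v ∈ V, v ≠ 0 → (u / v) ^ (2 ^ (2 * s)) = u / v) : Nat.card V ≤ 4 := by
  classical
  have hper : ∀ y : L, Function.IsPeriodicPt (frobenius L 2) n y := by
    intro y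
    have := Fintype.ofFinite L
    rw [Function.IsPeriodicPt, Function.IsFixedPt, iterate_frobenius, ← hL,
      Nat.card_eq_fintype_card, FiniteField.pow_card]
  have hfix : ∀ y : L, y ^ (2 ^ (2 * s)) = y → y ^ 4 = y := by
    intro y hy
    have h1 : Function.IsPeriodicPt (frobenius L 2) (2 * s) y := by
      rw [Function.IsPeriodicPt, Function.IsFixedPt, iterate_frobenius, hy]
    have h2 := h1.gcd (hper y)
    have hd : Nat.gcd (2 * s) n ∣ 2 := by
      rw [Nat.Coprime.gcd_mul_right_cancel 2 hs]
      exact Nat.gcd_dvd_left _ _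
    have h3 := h2.trans_dvd hd
    rw [Function.IsPeriodicPt, Function.IsFixedPt, iterate_frobenius] at h3
    simpa using h3
  by_cases h : ∃ v ∈ V, v ≠ 0
  · obtain ⟨v, hv, hv0⟩ := h
    let p : Polynomial L := Polynomial.X ^ 4 - Polynomial.X
    have hp0 : p ≠ 0 := FiniteField.X_pow_card_sub_X_ne_zero L (by norm_num)
    have hroots : p.roots.toFinset.card ≤ 4 := by
      refine (Multiset.toFinset_card_le _).trans ((Polynomial.card_roots' p).trans ?_)
      exact (FiniteField.X_pow_card_sub_X_natDegree_eq L (by norm_num : 1 < 4)).le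
    have hinj : Nat.card V ≤ Nat.card p.roots.toFinset := by
      refine Nat.card_le_card_of_injective
        (fun u : V => (⟨u / v, ?_⟩ : p.roots.toFinset)) ?_
      · rw [Multiset.mem_toFinset, Polynomial.mem_roots hp0]
        simp [p, Polynomial.IsRoot, hfix _ (hV u u.2 v hv hv0)]
      · intro u w huw
        have := congrArg Subtype.val huw
        exact Subtype.ext ((div_left_inj' hv0).1 this)
    rw [Nat.card_eq_fintype_card (α := p.roots.toFinset), Fintype.card_coe] at hinj
    exact hinj.trans hroots
  · push Not at h
    have : V = ⊥ := (AddSubgroup.eq_bot_iff_forall V).2 h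
    rw [this]; simp

theorem sq_cases (n c : ℕ) (hc : c ∣ 2 ^ n) (hc4 : c ≤ 4) (W : ℤ)
    (hW : W ^ 2 = 0 ∨ W ^ 2 = 2 ^ n * c) :
    (Odd n → W = 0 ∨ W = 2 ^ ((n + 1) / 2) ∨ W = -2 ^ ((n + 1) / 2)) ∧
    (Even n → W = 0 ∨ W = 2 ^ (n / 2) ∨ W = -2 ^ (n / 2) ∨
        W = 2 ^ ((n + 2) / 2) ∨ W = -2 ^ ((n + 2) / 2)) := by
  rcases hW with hW | hW
  · have : W = 0 := by simpa using hW
    simp [this]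
  have nonsq : ∀ e : ℕ, W ^ 2 ≠ 2 ^ (2 * e + 1) := by
    intro e he
    have h := congrArg Int.natAbs he
    rw [Int.natAbs_pow, Int.natAbs_pow] at h
    have h2 := congrArg (padicValNat 2) h
    have hp : Fact (Nat.Prime 2) := ⟨Nat.prime_two⟩
    rw [padicValNat.pow, padicValNat.pow] at h2
    simp at h2
    omega
  have issq : ∀ e : ℕ, W ^ 2 = 2 ^ (2 * e) → W = 2 ^ e ∨ W = -2 ^ e := by
    intro e he
    rw [mul_comm, pow_mul] at he
    exact sq_eq_sq_iff_eq_or_eq_neg.1 he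
  obtain ⟨d, -, rfl⟩ := (Nat.dvd_prime_pow Nat.prime_two).1 hc
  have hd : d ≤ 2 := by
    by_contra hd
    have := Nat.pow_le_pow_right (n := 2) (by norm_num) (show 3 ≤ d by omega)
    omega
  push_cast at hW
  rw [← pow_add] at hW
  constructor
  · rintro ⟨e, rfl⟩
    rw [show (2 * e + 1 + 1) / 2 = e + 1 by omega]
    interval_cases d
    · exact absurd hW (nonsq e)
    · exact .inr (issq (e + 1) hW)
    · exact absurd hW (nonsq (e + 1))
  · rintro ⟨e, rfl⟩
    rw [show (e + e + 2) / 2 = e + 1 by omega, show (e + e) / 2 = e by omega]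
    rw [← two_mul] at hW
    interval_cases d
    · have := issq e hW; tauto
    · exact absurd hW (nonsq e)
    · have := issq (e + 1) hW; tauto

theorem exists_log {L : Type*} [Field L] [Fintype L] (h7 : 7 ∣ Fintype.card L - 1)
    (t : L) (ht : ∀ y : L, y ≠ 0 → ∃ j : ℕ, y = t ^ j) (ht0 : t ≠ 0) :
    ∃ l : L → ZMod 7, (∀ x y, x ≠ 0 → y ≠ 0 → l (x * y) = l x + l y) ∧ l t = 1 := by
  classical
  have ho : orderOf t = Fintype.card L - 1 := by
    have h1 : orderOf (Units.mk0 t ht0) = Nat.card Lˣ := by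
      apply orderOf_eq_card_of_forall_mem_zpowers
      intro x
      obtain ⟨j, hj⟩ := ht x x.ne_zero
      exact ⟨j, by ext; simp [hj]⟩
    rw [← orderOf_units, Units.val_mk0, Nat.card_units, Nat.card_eq_fintype_card] at h1
    exact h1
  choose! j hj using ht
  have key : ∀ a b : ℕ, t ^ a = t ^ b → (a : ZMod 7) = b := by
    intro a b hab
    rw [ZMod.natCast_eq_natCast_iff]
    have hu : Units.mk0 t ht0 ^ a = Units.mk0 t ht0 ^ b := by ext; simpa using hab
    rw [pow_eq_pow_iff_modEq, ← orderOf_units, Units.val_mk0, ho] at hu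
    exact hu.of_dvd h7
  refine ⟨fun x => j x, fun x y hx hy => ?_, ?_⟩
  · rw [← Nat.cast_add]
    apply key
    rw [← hj _ (mul_ne_zero hx hy), pow_add, ← hj x hx, ← hj y hy]
  · rw [← Nat.cast_one]
    apply key
    rw [← hj t ht0, pow_one]

theorem log_pow {L : Type*} [Field L] (l : L → ZMod 7)
    (hl : ∀ x y, x ≠ 0 → y ≠ 0 → l (x * y) = l x + l y) (x : L) (hx : x ≠ 0) (m : ℕ) :
    l (x ^ m) = m * l x := by
  induction m with
  | zero =>
    have := hl 1 1 one_ne_zero one_ne_zero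
    simp_all
  | succ m ih =>
    rw [pow_succ, hl _ _ (pow_ne_zero m hx) hx, ih]; push_cast; ring

theorem trace_ringEquiv {L : Type*} [Field L] [Algebra (ZMod 2) L] (σ : L ≃+* L) (x : L) :
    Algebra.trace (ZMod 2) L (σ x) = Algebra.trace (ZMod 2) L x :=
  Algebra.trace_eq_of_algEquiv
    (AlgEquiv.ofRingEquiv (f := σ)
      (fun c => RingHom.congr_fun
        (RingHom.ext_zmod ((σ : L →+* L).comp (algebraMap (ZMod 2) L)) (algebraMap (ZMod 2) L)) c)) x

theorem linearized_eq {L : Type*} [Field L] [Finite L] [CharP L 2] [Algebra (ZMod 2) L]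
    (σ θ : L ≃+* L) (hc : ∀ x, θ (σ x) = σ (θ x)) (hθ : ∀ x, θ (θ (θ x)) = x) (r B u : L)
    (h : ∀ x, Algebra.trace (ZMod 2) L (B * r * (x * σ u + u * σ x) +
      B * θ r * (θ x * θ (θ (σ u)) + θ u * θ (θ (σ x)))) = 0) :
    σ r * (σ B * σ (σ u) - σ (θ (θ B)) * σ (σ (θ u))) =
      B * r * u - θ B * θ (θ r) * θ (θ u) := by
  have hz : σ r * (σ B * σ (σ u) + σ (θ (θ B)) * σ (σ (θ u))) +
      (B * r * u + θ B * θ (θ r) * θ (θ u)) = 0 := by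
    apply (traceForm_nondegenerate (ZMod 2) L).1
    intro w
    obtain ⟨x, rfl⟩ := σ.surjective w
    rw [Algebra.traceForm_apply]
    have e := h x
    have e1 := trace_ringEquiv σ (B * r * (x * σ u))
    have e2 := trace_ringEquiv θ (B * θ r * (θ u * θ (θ (σ x))))
    have e3 := trace_ringEquiv ((θ.trans θ).trans σ) (B * θ r * (θ x * θ (θ (σ u))))
    simp only [RingEquiv.coe_trans, Function.comp_apply, map_mul, hc, hθ] at e1 e2 e3
    simp only [mul_add, map_add, hc] at e
    rw [← e1, ← e2, ← e3] at e
    simp only [← map_add] at e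
    rw [← e]
    congr 1
    ring
  rw [CharTwo.sub_eq_add, CharTwo.sub_eq_add]
  exact CharTwo.add_eq_zero.1 hz

theorem walsh_sq {L : Type*} [Field L] [Fintype L] [CharP L 2] [Algebra (ZMod 2) L]
    (s n : ℕ) (hs : Nat.gcd s n = 1) (hL : Fintype.card L = 2 ^ n)
    (σ θ : L ≃+* L) (hσ : ∀ x, σ x = x ^ 2 ^ s) (hc : ∀ x, θ (σ x) = σ (θ x))
    (hθ : ∀ x, θ (θ (θ x)) = x) (l : L → ZMod 7)
    (hl : ∀ x y, x ≠ 0 → y ≠ 0 → l (x * y) = l x + l y) (q : ZMod 7) (hq : q = 2 ∨ q = 4)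
    (hσl : ∀ x, x ≠ 0 → l (σ x) = q * l x) (hθl : ∀ x, x ≠ 0 → l (θ x) = q * l x)
    (r b : L) (hr : r ≠ 0) (hb : b ≠ 0) (hlr : l r ≠ 0) (a : L) (W : ℤ)
    (hW : W = ∑ x : L, (-1 : ℤ) ^ (Algebra.trace (ZMod 2) L
      (a * x + b * (x * σ x + θ r / r * (θ x * θ (θ (σ x)))))).val) :
    ∃ c : ℕ, c ∣ 2 ^ n ∧ c ≤ 4 ∧ (W ^ 2 = 0 ∨ W ^ 2 = 2 ^ n * c) := by
  obtain ⟨B, rfl⟩ : ∃ B, b = B * r := ⟨b / r, by field_simp⟩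
  have hB : B ≠ 0 := left_ne_zero_of_mul hb
  let D : L → L → ZMod 2 := fun x u => Algebra.trace (ZMod 2) L
    (B * r * (x * σ u + u * σ x) + B * θ r * (θ x * θ (θ (σ u)) + θ u * θ (θ (σ x))))
  have hD : ∀ x y u, D (x + y) u = D x u + D y u := by
    intro x y u
    simp only [D, ← map_add]
    congr 1
    simp only [map_add]
    ring
  have hD' : ∀ x u, D x u = D u x := by
    intro x u
    simp only [D]
    congr 1
    ring
  let V : AddSubgroup L :=
    { carrier := {u | ∀ x, D x u = 0}
      add_mem' := by
        intro u v hu hv x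
        rw [hD', hD, hD' u, hD' v, hu, hv, add_zero]
      zero_mem' := by
        intro x
        simp [D]
      neg_mem' := by
        intro u hu
        rwa [CharTwo.neg_eq] }
  refine ⟨Nat.card V, ?_, ?_, ?_⟩
  · rw [← hL, ← Nat.card_eq_fintype_card]
    exact AddSubgroup.card_addSubgroup_dvd_card V
  · apply card_le_four s n hs (by rw [Nat.card_eq_fintype_card, hL]) V
    intro u hu v hv hv0
    have := linearized_roots_ratio_fixed (σ : L →+* L) (θ : L →+* L) hc hθ l hl q hq
      hσl hθl r B hr hB hlr u v hv0
      (linearized_eq σ θ hc hθ r B u hu) (linearized_eq σ θ hc hθ r B v hv)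
    simp only [RingEquiv.coe_toRingHom, hσ] at this
    rw [two_mul, pow_add, pow_mul]
    exact this
  · have := quadratic_sum_sq (fun x => Algebra.trace (ZMod 2) L
      (a * x + B * r * (x * σ x + θ r / r * (θ x * θ (θ (σ x)))))) D ?_ hD V (fun u => Iff.rfl)
    · rw [← hW, hL] at this
      exact_mod_cast this
    · intro x u
      simp only [D, ← map_add]
      congr 1
      simp only [map_add]
      field_simp
      ring

/-- Let `f(x) = x^{2^s+1} + α x^{2^{ik} + 2^{mk+s}}` be the binomial of Family (1) on
`L = GF(2^{3k})` (so `n = 3k`, `k ≥ 3`, `gcd(k,3) = 1`, `gcd(s,3k) = 1`, `i ∈ {1,2}`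
with `i ≡ sk (mod 3)`, `m ∈ {1,2}` with `m ≡ -i (mod 3)`, `α = t^{2^k-1}` with `t`
primitive).  Then for every `a ∈ L` and `b ∈ L^*`, the Fourier (Walsh) transform
value `f^W(a,b) = ∑_{x ∈ L} (-1)^{Tr(ax + b f(x))}` lies in `{0, ±2^{(n+1)/2}}` when
`n` is odd, and in `{0, ±2^{n/2}, ±2^{(n+2)/2}}` when `n` is even. -/
theorem stmt2 (k s : ℕ) (hk : 3 ≤ k) (hk3 : Nat.gcd k 3 = 1)
    (hs : 0 < s) (hgcd : Nat.gcd s (3 * k) = 1)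
    (i m : ℕ) (hi : i = 1 ∨ i = 2) (hisk : i % 3 = (s * k) % 3)
    (hm : m = 1 ∨ m = 2) (hmi : (m + i) % 3 = 0)
    (L : Type*) [Field L] [Fintype L] [Algebra (ZMod 2) L]
    (hcard : Fintype.card L = 2 ^ (3 * k))
    (t : L) (ht : ∀ y : L, y ≠ 0 → ∃ j : ℕ, y = t ^ j)
    (α : L) (hα : α = t ^ (2 ^ k - 1))
    (f : L → L) (hf : ∀ x, f x = x ^ (2 ^ s + 1) + α * x ^ (2 ^ (i * k) + 2 ^ (m * k + s)))
    (a b : L) (hb : b ≠ 0)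
    (W : ℤ)
    (hW : W = ∑ x : L, (-1 : ℤ) ^ (Algebra.trace (ZMod 2) L (a * x + b * f x)).val) :
    (Odd (3 * k) →
      W = 0 ∨ W = 2 ^ ((3 * k + 1) / 2) ∨ W = -2 ^ ((3 * k + 1) / 2)) ∧
    (Even (3 * k) →
      W = 0 ∨ W = 2 ^ ((3 * k) / 2) ∨ W = -2 ^ ((3 * k) / 2) ∨
        W = 2 ^ ((3 * k + 2) / 2) ∨ W = -2 ^ ((3 * k + 2) / 2)) := by
  have hC : CharP L 2 := (Algebra.charP_iff (ZMod 2) L 2).1 inferInstance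
  have hE : ExpChar L 2 := ExpChar.prime Nat.prime_two
  have hcard' : ∀ x : L, x ^ 2 ^ (3 * k) = x := fun x => by
    rw [← hcard, FiniteField.pow_card]
  have hm7 : ∀ e : ℕ, (2 : ZMod 7) ^ e = 2 ^ (e % 3) := by
    intro e
    conv_lhs => rw [← Nat.div_add_mod e 3, pow_add, pow_mul, show (2 : ZMod 7) ^ 3 = 1 by decide,
      one_pow, one_mul]
  have h7 : 7 ∣ Fintype.card L - 1 := by
    rw [hcard, pow_mul]
    have := Nat.sub_dvd_pow_sub_pow (2 ^ 3) 1 k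
    rwa [one_pow] at this
  have hs3 : s % 3 = 1 ∨ s % 3 = 2 := by
    have h1 : ¬ 3 ∣ s := fun h => by
      have := Nat.dvd_gcd h (Dvd.intro k rfl : 3 ∣ 3 * k)
      rw [hgcd] at this
      omega
    omega
  have hk3' : k % 3 = 1 ∨ k % 3 = 2 := by
    have h1 : ¬ 3 ∣ k := fun h => by
      have := Nat.dvd_gcd h (dvd_refl 3)
      rw [hk3] at this
      omega
    omega
  have hik : (i * k) % 3 = s % 3 := by
    rw [Nat.mul_mod, hisk, Nat.mul_mod s k]
    rcases hs3 with h | h <;> rcases hk3' with h' | h' <;> simp [h, h']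
  have ht0 : t ≠ 0 := by
    rintro rfl
    have hlt : 2 < Fintype.card L := by
      rw [hcard]
      calc 2 < 2 ^ 3 := by norm_num
        _ ≤ 2 ^ (3 * k) := Nat.pow_le_pow_right (by norm_num) (by omega)
    classical
    have hsub : (Finset.univ : Finset L) ⊆ {0, 1} := by
      intro y _
      by_cases hy : y = 0
      · simp [hy]
      · obtain ⟨j, hj⟩ := ht y hy
        have hj0 : j = 0 := by
          by_contra h
          exact hy (by rw [hj, zero_pow h])
        simp [hj, hj0]
    have := (Finset.card_le_card hsub).trans Finset.card_le_two
    rw [Finset.card_univ] at this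
    omega
  obtain ⟨l, hl, hlt⟩ := exists_log h7 t ht ht0
  let σ := iterateFrobeniusEquiv L 2 s
  let θ := iterateFrobeniusEquiv L 2 (i * k)
  have hσ : ∀ x, σ x = x ^ 2 ^ s := iterateFrobeniusEquiv_def L 2 s
  have hθ' : ∀ x, θ x = x ^ 2 ^ (i * k) := iterateFrobeniusEquiv_def L 2 (i * k)
  have hc : ∀ x, θ (σ x) = σ (θ x) := fun x => by rw [hσ, hθ', hσ, hθ', pow_right_comm]
  have hθθ : ∀ x, θ (θ x) = x ^ 2 ^ (m * k) := by
    intro x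
    rw [hθ', hθ', ← pow_mul, ← pow_add]
    rcases hi with rfl | rfl <;> rcases hm with rfl | rfl <;> try omega
    · rw [← add_mul]
    · rw [show 2 * k + 2 * k = 3 * k + 1 * k by ring, pow_add, pow_mul, hcard']
  have hθ : ∀ x, θ (θ (θ x)) = x := by
    intro x
    rw [hθθ, hθ', ← pow_mul, ← pow_add]
    rcases hi with rfl | rfl <;> rcases hm with rfl | rfl <;> try omega
    · rw [← add_mul]; exact hcard' x
    · rw [← add_mul]; exact hcard' x
  have hσl : ∀ x, x ≠ 0 → l (σ x) = 2 ^ s * l x := fun x hx => by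
    rw [hσ, log_pow l hl x hx]; push_cast; rfl
  have hθl : ∀ x, x ≠ 0 → l (θ x) = 2 ^ s * l x := fun x hx => by
    rw [hθ', log_pow l hl x hx, hm7 s, ← hik, ← hm7]; push_cast; rfl
  have hq : (2 : ZMod 7) ^ s = 2 ∨ (2 : ZMod 7) ^ s = 4 := by
    rw [hm7]
    rcases hs3 with h | h <;> rw [h] <;> decide
  have hαt : α * t = t ^ 2 ^ k := by
    rw [hα, ← pow_succ, Nat.sub_add_cancel Nat.one_le_two_pow]
  obtain ⟨r, hr, hlr, hαr⟩ : ∃ r, r ≠ 0 ∧ l r ≠ 0 ∧ α = θ r / r := by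
    rcases hi with rfl | rfl
    · refine ⟨t, ht0, by rw [hlt]; decide, ?_⟩
      rw [eq_div_iff ht0, hαt, hθ', one_mul]
    · have hm1 : m = 1 := by omega
      subst hm1
      have h2 : θ (θ t) ≠ 0 := by rw [hθθ]; exact pow_ne_zero _ ht0
      refine ⟨(θ (θ t))⁻¹, inv_ne_zero h2, ?_, ?_⟩
      · intro h
        have h1 := hl _ _ h2 (inv_ne_zero h2)
        have h3 := hl 1 1 one_ne_zero one_ne_zero
        rw [mul_inv_cancel₀ h2, h, hθl _ ((map_ne_zero θ).2 ht0), hθl _ ht0, hlt] at h1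
        rw [mul_one] at h3
        revert h1 h3
        generalize l 1 = z
        rcases hq with h | h <;> rw [h] <;> revert z <;> decide
      · rw [map_inv₀, hθ, div_inv_eq_mul, inv_mul_eq_div, eq_div_iff ht0, hαt, hθθ, one_mul]
  obtain ⟨c, hc1, hc2, hc3⟩ := walsh_sq s (3 * k) hgcd hcard σ θ hσ hc hθ l hl _ hq hσl hθl r b
    hr hb hlr a W (by
      rw [hW]
      refine Finset.sum_congr rfl fun x _ => ?_
      rw [hf, hαr, hθθ, hθ' x, hσ x, ← pow_mul, ← pow_add (2 : ℕ), pow_add x, pow_add x,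
        add_comm s, pow_one, mul_comm (x ^ 2 ^ s)])
  exact sq_cases (3 * k) c hc1 hc2 W hc3
end

section
/- Let f be the binomial of Family (2) on L = GF(2^{4k}). Then for every a ∈ L and every b ∈ L*, the Fourier transform value f^W(a,b) lies in {0, +2^{n/2}, −2^{n/2}, +2^{(n+2)/2}, −2^{(n+2)/2}}, where n = 4k. -/
/-- The square of the sign sum of a quadratic form over `GF(2)` is zero or the product of the
cardinalities of the space and of the radical of the polar form. -/
theorem sign_sum_eq_zero_or_sq_eq {V : Type*} [AddCommGroup V] [Fintype V] (g : V → ZMod 2)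
    (hadd : ∀ x y z, g (x + y + z) + g (x + y) + g z
      = (g (x + z) + g x + g z) + (g (y + z) + g y + g z))
    (K : AddSubgroup V) (hK : ∀ u, u ∈ K ↔ ∀ x, g (x + u) + g x + g u = 0) :
    ∑ x, (-1 : ℤ) ^ (g x).val = 0 ∨
      (∑ x, (-1 : ℤ) ^ (g x).val) ^ 2 = Fintype.card V * Nat.card K := by
  classical
  have hψ : ∀ a b : ZMod 2, (-1 : ℤ) ^ (a + b).val = (-1) ^ a.val * (-1) ^ b.val := by decide
  have h2 : ∀ a : ZMod 2, a + a = 0 := by decide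
  have hne : ∀ a : ZMod 2, a ≠ 0 → (-1 : ℤ) ^ a.val = -1 := by decide
  have shift_zero : ∀ (S : Finset V) (h : V → ZMod 2) (y : V), (∀ x, y + x ∈ S ↔ x ∈ S) →
      h y ≠ 0 → (∀ x ∈ S, h (y + x) = h y + h x) → ∑ x ∈ S, (-1 : ℤ) ^ (h x).val = 0 := by
    intro S h y hS hy hh
    have : ∑ x ∈ S, (-1 : ℤ) ^ (h x).val = ∑ x ∈ S, (-1 : ℤ) ^ (h (y + x)).val := by
      symm
      exact Finset.sum_equiv (Equiv.addLeft y) (fun x => (hS x).symm) (fun x _ => rfl)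
    have h3 : ∑ x ∈ S, (-1 : ℤ) ^ (h (y + x)).val = - ∑ x ∈ S, (-1 : ℤ) ^ (h x).val := by
      rw [← Finset.sum_neg_distrib]
      refine Finset.sum_congr rfl fun x hx => ?_
      rw [hh x hx, hψ, hne _ hy]
      ring
    linarith
  have hinner : ∀ u, ∑ x, (-1 : ℤ) ^ (g (x + u) + g x + g u).val
      = if u ∈ K then (Fintype.card V : ℤ) else 0 := by
    intro u
    split_ifs with hu
    · rw [Finset.sum_congr rfl fun x _ => by rw [(hK u).1 hu x]]
      simp
    · rw [hK] at hu
      push Not at hu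
      obtain ⟨y, hy⟩ := hu
      refine shift_zero Finset.univ (fun x => g (x + u) + g x + g u) y (by simp) hy ?_
      intro x _
      have := hadd y x u
      linear_combination this
  have hsq : (∑ x, (-1 : ℤ) ^ (g x).val) ^ 2
      = Fintype.card V * ∑ u with u ∈ K, (-1 : ℤ) ^ (g u).val := by
    rw [sq, Finset.sum_mul_sum]
    have : ∀ x, ∑ y, (-1 : ℤ) ^ (g x).val * (-1 : ℤ) ^ (g y).val
        = ∑ u, (-1 : ℤ) ^ (g u).val * (-1 : ℤ) ^ (g (x + u) + g x + g u).val := by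
      intro x
      rw [← Equiv.sum_comp (Equiv.addLeft x)]
      refine Finset.sum_congr rfl fun u _ => ?_
      rw [← hψ, ← hψ]
      congr 2
      simp only [Equiv.coe_addLeft]
      linear_combination -h2 (g u)
    rw [Finset.sum_congr rfl fun x _ => this x, Finset.sum_comm, Finset.mul_sum,
      Finset.sum_filter]
    refine Finset.sum_congr rfl fun u _ => ?_
    rw [← Finset.mul_sum, hinner]
    split_ifs <;> ring
  by_cases h : ∀ u ∈ K, g u = 0
  · right
    rw [hsq, Finset.sum_congr rfl fun u hu => by rw [h u (Finset.mem_filter.1 hu).2]]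
    simp [Nat.card_eq_fintype_card, Fintype.card_subtype]
  · left
    push Not at h
    obtain ⟨y, hyK, hy⟩ := h
    rw [← pow_eq_zero_iff two_ne_zero, hsq, shift_zero _ g y _ hy, mul_zero]
    · intro x hx
      have := (hK x).1 (Finset.mem_filter.1 hx).2 y
      linear_combination this - h2 (g x) - h2 (g y)
    · intro x
      simp [K.add_mem_cancel_left hyK]

/-- If the radical of the polar form of a quadratic form over `GF(2)` in `2d` variables has at most
four elements, the sign sum is `0`, `±2^d` or `±2^(d+1)`. -/
theorem sign_sum_spectrum {V : Type*} [AddCommGroup V] [Fintype V] (g : V → ZMod 2)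
    (hadd : ∀ x y z, g (x + y + z) + g (x + y) + g z
      = (g (x + z) + g x + g z) + (g (y + z) + g y + g z))
    (K : AddSubgroup V) (hK : ∀ u, u ∈ K ↔ ∀ x, g (x + u) + g x + g u = 0)
    {d : ℕ} (hV : Fintype.card V = 2 ^ (2 * d)) (hK4 : Nat.card K ≤ 4)
    {W : ℤ} (hW : W = ∑ x, (-1 : ℤ) ^ (g x).val) :
    W = 0 ∨ W = 2 ^ d ∨ W = -2 ^ d ∨ W = 2 ^ (d + 1) ∨ W = -2 ^ (d + 1) := by
  rcases sign_sum_eq_zero_or_sq_eq g hadd K hK with h | h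
  · exact Or.inl (hW.trans h)
  rw [← hW, hV] at h
  have hdvd : Nat.card K ∣ 2 ^ (2 * d) := by
    rw [← hV, ← Nat.card_eq_fintype_card]
    exact K.card_addSubgroup_dvd_card
  obtain ⟨j, -, hj⟩ := (Nat.dvd_prime_pow Nat.prime_two).1 hdvd
  rw [hj] at h hK4
  have hj2 : j ≤ 2 := by
    by_contra! hlt
    have := Nat.pow_le_pow_right (show 0 < 2 by norm_num) (show 3 ≤ j from hlt)
    omega
  push_cast at h
  interval_cases j
  · have : W ^ 2 = (2 ^ d) ^ 2 := by rw [h]; ring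
    rcases sq_eq_sq_iff_eq_or_eq_neg.1 this with h | h <;> simp [h]
  · exfalso
    have h1 : W.natAbs ^ 2 = 2 ^ (2 * d + 1) := by
      zify
      rw [sq_abs, h]; ring
    have h2 := congrArg (fun x => x.factorization 2) h1
    simp [Nat.factorization_pow, Nat.prime_two.factorization] at h2
    omega
  · have : W ^ 2 = (2 ^ (d + 1)) ^ 2 := by rw [h]; ring
    rcases sq_eq_sq_iff_eq_or_eq_neg.1 this with h | h <;> simp [h]

/-- Any two solutions of the linearized equation differ by a factor fixed by `σ²`. Here `ρ²` plays
the role of a conjugation, and the proof compares the determinants of a pair of conjugate solutions. -/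
theorem fixed_div_of_linearized {L : Type*} [Field L] [CharP L 2] (σ ρ : L →+* L)
    (hcomm : ∀ x, ρ (σ x) = σ (ρ x)) (hρ : ∀ x, ρ (ρ (ρ (ρ x))) = x)
    (hσ : ∀ x, σ x = x → x ≠ 0 → x = 1)
    {r : L} (hr : r ≠ 0)
    (hcube : ∀ D w, ρ D = D → ρ (ρ w) = w → r * ρ (ρ r) * D * (w * σ w) ≠ 1)
    (hfifth : ∀ B, B ≠ 0 → σ (ρ (ρ r)) * σ (ρ B) * B ≠ ρ (ρ (ρ B)) * σ B * σ r)
    {B : L} (hB : B ≠ 0) {u v : L} (hu0 : u ≠ 0)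
    (hu : σ r * (σ B * σ (σ u) + σ (ρ (ρ (ρ B))) * σ (σ (ρ (ρ u))))
      = r * B * u + ρ (ρ r) * ρ B * ρ (ρ u))
    (hv : σ r * (σ B * σ (σ v) + σ (ρ (ρ (ρ B))) * σ (σ (ρ (ρ v))))
      = r * B * v + ρ (ρ r) * ρ B * ρ (ρ v)) :
    σ (σ (v / u)) = v / u := by
  have hu' := congrArg (fun x => ρ (ρ x)) hu
  have hv' := congrArg (fun x => ρ (ρ x)) hv
  simp only [map_mul, map_add, hcomm, hρ] at hu' hv'
  have hinj : ∀ {x : L}, x ≠ 0 → σ x ≠ 0 := fun h => (map_ne_zero σ).2 h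
  have hinjρ : ∀ {x : L}, x ≠ 0 → ρ x ≠ 0 := fun h => (map_ne_zero ρ).2 h
  have hD : B * ρ (ρ B) - ρ B * ρ (ρ (ρ B)) ≠ 0 := by
    intro hD
    have hσD := congrArg σ hD
    simp only [map_mul, map_sub, map_zero] at hσD
    apply hfifth B hB
    by_cases hQ : σ B * σ (σ u) + σ (ρ (ρ (ρ B))) * σ (σ (ρ (ρ u))) = 0
    · have h1 : B * σ u + ρ (ρ (ρ B)) * σ (ρ (ρ u)) = 0 := by
        apply σ.injective
        simpa using hQ
      have h2 : σ r * σ B * σ u + σ (ρ (ρ r)) * σ (ρ B) * σ (ρ (ρ u)) = 0 := by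
        rw [hQ, mul_zero] at hu
        simpa using (congrArg σ hu).symm
      apply mul_right_cancel₀ (hinj (hinjρ (hinjρ hu0)))
      linear_combination B * h2 - σ r * σ B * h1
    · apply mul_right_cancel₀ hQ
      linear_combination B * σ B * hu' - ρ (ρ (ρ B)) * σ B * hu
        - B * σ (ρ (ρ r)) * σ (σ (ρ (ρ u))) * hσD + σ B * ρ (ρ r) * ρ (ρ u) * hD
  have hw : u * ρ (ρ v) - ρ (ρ u) * v = 0 := by
    by_contra hw
    have hdet : σ r * σ (ρ (ρ r)) * (σ B * σ (ρ (ρ B)) - σ (ρ B) * σ (ρ (ρ (ρ B))))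
          * (σ (σ u) * σ (σ (ρ (ρ v))) - σ (σ (ρ (ρ u))) * σ (σ v))
        = r * ρ (ρ r) * (B * ρ (ρ B) - ρ B * ρ (ρ (ρ B))) * (u * ρ (ρ v) - ρ (ρ u) * v) := by
      have := congrArg₂ (fun x y => x - y) (congrArg₂ (fun x y => x * y) hu hv')
        (congrArg₂ (fun x y => x * y) hu' hv)
      linear_combination this
    refine hcube (B * ρ (ρ B) - ρ B * ρ (ρ (ρ B))) (u * ρ (ρ v) - ρ (ρ u) * v) ?_ ?_
      (hσ _ ?_ ?_)
    · simp only [map_mul, map_sub, hρ]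
      rw [← CharTwo.neg_eq (_ - _)]; ring
    · simp only [map_mul, map_sub, hρ]
      rw [← CharTwo.neg_eq (_ - _)]; ring
    · simp only [map_mul, map_sub]
      linear_combination (σ u * σ (ρ (ρ v)) - σ (ρ (ρ u)) * σ v) * hdet
    · exact mul_ne_zero (mul_ne_zero (mul_ne_zero hr (hinjρ (hinjρ hr))) hD)
        (mul_ne_zero hw (hinj hw))
  obtain ⟨c, rfl⟩ : ∃ c, v = c * u := ⟨v / u, (div_mul_cancel₀ v hu0).symm⟩
  rw [mul_div_cancel_right₀ c hu0]
  have hc : ρ (ρ c) = c := by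
    apply mul_right_cancel₀ (mul_ne_zero hu0 (hinjρ (hinjρ hu0)))
    simp only [map_mul] at hw
    linear_combination hw
  simp only [map_mul, hc] at hv hv'
  by_contra hne
  have hne' : σ (σ c) - c ≠ 0 := sub_ne_zero.2 hne
  have h1 : r * B * u + ρ (ρ r) * ρ B * ρ (ρ u) = 0 := by
    apply (mul_eq_zero.1 (_ : (σ (σ c) - c) * _ = 0)).resolve_left hne'
    linear_combination hv - σ (σ c) * hu
  have h2 : ρ (ρ r) * ρ (ρ B) * ρ (ρ u) + r * ρ (ρ (ρ B)) * u = 0 := by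
    apply (mul_eq_zero.1 (_ : (σ (σ c) - c) * _ = 0)).resolve_left hne'
    linear_combination hv' - σ (σ c) * hu'
  apply mul_ne_zero (mul_ne_zero hr hD) hu0
  linear_combination ρ (ρ B) * h1 - ρ B * h2

/-- Elements of the radical of the polar form satisfy the linearized equation. -/
theorem linearized_of_trace_eq_zero {L : Type*} [Field L] [Finite L] [Algebra (ZMod 2) L]
    (σ ρ : L →+* L) (hcomm : ∀ x, ρ (σ x) = σ (ρ x)) (hρ : ∀ x, ρ (ρ (ρ (ρ x))) = x)
    (hσtr : ∀ x, Algebra.trace (ZMod 2) L (σ x) = Algebra.trace (ZMod 2) L x)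
    (hρtr : ∀ x, Algebra.trace (ZMod 2) L (ρ x) = Algebra.trace (ZMod 2) L x) {r B u : L}
    (h : ∀ x, Algebra.trace (ZMod 2) L (r * B * (x * σ u + u * σ x)
      + ρ r * B * (ρ x * σ (ρ (ρ (ρ u))) + ρ u * σ (ρ (ρ (ρ x))))) = 0) :
    σ r * (σ B * σ (σ u) + σ (ρ (ρ (ρ B))) * σ (σ (ρ (ρ u))))
      = r * B * u + ρ (ρ r) * ρ B * ρ (ρ u) := by
  have : CharP L 2 := charP_of_injective_algebraMap (algebraMap (ZMod 2) L).injective 2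
  rw [← CharTwo.add_eq_zero]
  apply (traceForm_nondegenerate (ZMod 2) L).1
  intro y
  obtain ⟨x, rfl⟩ := (Finite.injective_iff_surjective.1 σ.injective) y
  rw [Algebra.traceForm_apply, ← h x]
  have e1 := hσtr (r * B * (x * σ u))
  have e2 : Algebra.trace (ZMod 2) L _ = _ :=
    (hσtr _).trans ((hρtr _).trans ((hρtr _).trans (hρtr (ρ r * B * (ρ x * σ (ρ (ρ (ρ u))))))))
  have e3 := hρtr (ρ r * B * (ρ u * σ (ρ (ρ (ρ x)))))
  simp only [map_mul, hcomm, hρ] at e1 e2 e3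
  simp only [mul_add, add_mul, map_add]
  rw [← e1, ← e2, ← e3]
  simp only [← map_add]
  congr 1
  ring

theorem trace_pow_two_pow {L : Type*} [Field L] [Finite L] [Algebra (ZMod 2) L] (j : ℕ) (x : L) :
    Algebra.trace (ZMod 2) L (x ^ 2 ^ j) = Algebra.trace (ZMod 2) L x := by
  induction j with
  | zero => simp
  | succ j ih =>
    rw [← ih, pow_succ, pow_mul,
      ← Algebra.trace_eq_of_algEquiv (FiniteField.frobeniusAlgEquivOfAlgebraic (ZMod 2) L)
        (x ^ 2 ^ j)]
    simp [ZMod.card]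

theorem pow_two_pow_gcd_eq {M : Type*} [Monoid M] {x : M} {j l : ℕ} (hj : x ^ 2 ^ j = x)
    (hl : x ^ 2 ^ l = x) : x ^ 2 ^ j.gcd l = x := by
  have key : ∀ n, Function.IsPeriodicPt (fun y : M => y ^ 2) n x ↔ x ^ 2 ^ n = x := fun n => by
    rw [Function.IsPeriodicPt, Function.IsFixedPt, pow_iterate]
  exact (key _).1 (((key j).2 hj).gcd ((key l).2 hl))

theorem card_pow_four_eq_self_le (L : Type*) [Field L] [Finite L] :
    Nat.card {x : L // x ^ 4 = x} ≤ 4 := by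
  classical
  have := Fintype.ofFinite L
  have hdeg : (Polynomial.X ^ 4 - Polynomial.X : Polynomial L).natDegree = 4 := by
    compute_degree!
  have hne : (Polynomial.X ^ 4 - Polynomial.X : Polynomial L) ≠ 0 := by
    intro h
    simp [h] at hdeg
  rw [Nat.card_eq_fintype_card, Fintype.card_subtype, ← hdeg]
  refine le_trans (Finset.card_le_card ?_)
    ((Multiset.toFinset_card_le _).trans (Polynomial.card_roots' (Polynomial.X ^ 4 - Polynomial.X)))
  intro x hx
  simpa [hne, hdeg, sub_eq_zero] using hx

theorem two_pow_mod_five {s p : ℕ} (hs : s % 2 = 1) (h : p % 4 = s % 4) :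
    2 ^ p % 5 = 2 ^ s % 5 ∧ (2 ^ s % 5 = 2 ∨ 2 ^ s % 5 = 3) := by
  have key : ∀ j, 2 ^ j % 5 = 2 ^ (j % 4) % 5 := fun j => by
    conv_lhs => rw [← Nat.div_add_mod j 4, pow_add, pow_mul, Nat.mul_mod, Nat.pow_mod]
    norm_num
  rw [key p, key s, h]
  have : s % 4 = 1 ∨ s % 4 = 3 := by omega
  rcases this with h | h <;> rw [h] <;> norm_num

theorem pow_two_pow_sub_one_eq_one {L : Type*} [Field L] {x : L} (hx : x ≠ 0) {j : ℕ}
    (h : x ^ 2 ^ j = x) : x ^ (2 ^ j - 1) = 1 := by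
  apply mul_right_cancel₀ hx
  rw [← pow_succ, Nat.sub_add_cancel Nat.one_le_two_pow, h, one_mul]

theorem primitive_norm_mul_ne_one {L : Type*} [Field L] {k s i : ℕ} (hk : Odd k) (hs : Odd s)
    (hi : i = 1 ∨ i = 3) (hL : ∀ x : L, x ^ 2 ^ (4 * k) = x)
    {r : L} (hr : ∀ j, r ^ j = 1 → 2 ^ (4 * k) - 1 ∣ j) {D w : L}
    (hD : D ^ 2 ^ (i * k) = D) (hw : (w ^ 2 ^ (i * k)) ^ 2 ^ (i * k) = w) :
    r * (r ^ 2 ^ (i * k)) ^ 2 ^ (i * k) * D * (w * w ^ 2 ^ s) ≠ 1 := by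
  intro h
  have hD0 : D ≠ 0 := by rintro rfl; simp at h
  have hw0 : w ≠ 0 := by rintro rfl; simp at h
  have hi4 : (i * k).gcd (4 * k) = k := by rcases hi with rfl | rfl <;> simp [Nat.gcd_mul_right]
  have hi2 : (i * k).gcd (2 * k) = k := by rcases hi with rfl | rfl <;> simp [Nat.gcd_mul_right]
  rw [← pow_mul, ← pow_add, ← two_mul] at hw
  have hDk : D ^ (2 ^ k - 1) = 1 :=
    pow_two_pow_sub_one_eq_one hD0 (by have := pow_two_pow_gcd_eq hD (hL D); rwa [hi4] at this)
  have hwk : w ^ (2 ^ (2 * k) - 1) = 1 := by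
    apply pow_two_pow_sub_one_eq_one hw0
    have := pow_two_pow_gcd_eq hw (hL w)
    rwa [show 4 * k = 2 * (2 * k) by ring, Nat.gcd_mul_left, hi2] at this
  obtain ⟨a, ha⟩ : ∃ a, 2 ^ k = a + 1 := ⟨2 ^ k - 1, by have := Nat.one_le_two_pow (n := k); omega⟩
  have ha0 : 0 < a := by
    have := Nat.pow_le_pow_right (show 0 < 2 by norm_num) hk.pos
    omega
  obtain ⟨c, hc⟩ : 3 ∣ 2 ^ k + 1 := by simpa using hk.nat_add_dvd_pow_add_pow 2 1
  obtain ⟨d, hd⟩ : 3 ∣ 2 ^ s + 1 := by simpa using hs.nat_add_dvd_pow_add_pow 2 1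
  have hN2 : 2 ^ (2 * k) - 1 = a * (3 * c) := by
    rw [mul_comm 2 k, pow_mul, ← hc, ha]
    apply Nat.sub_eq_of_eq_add
    ring
  have hN4 : 2 ^ (4 * k) - 1 = 3 * ((a * c) * ((a + 1) ^ 2 + 1)) := by
    have h3 : 3 * ((a * c) * ((a + 1) ^ 2 + 1)) = a * (3 * c) * ((a + 1) ^ 2 + 1) := by ring
    rw [h3, mul_comm 4 k, pow_mul, ← hc, ha]
    apply Nat.sub_eq_of_eq_add
    ring
  rw [ha, Nat.add_sub_cancel] at hDk
  rw [hN2] at hwk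
  have hre : r ^ ((1 + 2 ^ (i * k) * 2 ^ (i * k)) * (a * c)) = 1 := by
    have h1 := congrArg (fun x => x ^ (a * c)) h
    simp only [one_pow] at h1
    rw [mul_pow, mul_pow, ← pow_succ', hd, ← pow_mul w, pow_mul D, hDk, one_pow, mul_one,
      show 3 * d * (a * c) = a * (3 * c) * d by ring, pow_mul w, hwk, one_pow, mul_one,
      ← pow_mul, ← pow_succ', ← pow_mul, add_comm] at h1
    exact h1
  have hdvd := hr _ hre
  rw [hN4, mul_comm (1 + _)] at hdvd
  have hac : 0 < a * c := Nat.mul_pos ha0 (by omega)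
  have h3 : 3 ∣ 1 + 2 ^ (i * k) * 2 ^ (i * k) := by
    apply Nat.dvd_of_mul_dvd_mul_left hac
    refine Dvd.dvd.trans ⟨(a + 1) ^ 2 + 1, ?_⟩ hdvd
    ring
  rw [← mul_pow, Nat.dvd_iff_mod_eq_zero, Nat.add_mod, Nat.pow_mod] at h3
  norm_num at h3

theorem primitive_ratio_ne {L : Type*} [Field L] {k s p : ℕ} (hs : Odd s)
    (hp : p % 4 = s % 4) (hL : ∀ x : L, x ^ 2 ^ (4 * k) = x)
    {r : L} (hr0 : r ≠ 0) (hr : ∀ j, r ^ j = 1 → 2 ^ (4 * k) - 1 ∣ j) (hk : 0 < k)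
    {B : L} (hB : B ≠ 0) :
    ((r ^ 2 ^ p) ^ 2 ^ p) ^ 2 ^ s * (B ^ 2 ^ p) ^ 2 ^ s * B
      ≠ ((B ^ 2 ^ p) ^ 2 ^ p) ^ 2 ^ p * B ^ 2 ^ s * r ^ 2 ^ s := by
  intro h
  obtain ⟨hpq, hq⟩ := two_pow_mod_five (Nat.odd_iff.1 hs) hp
  obtain ⟨e, he⟩ : 5 ∣ 2 ^ (4 * k) - 1 := by
    rw [pow_mul]
    exact Dvd.dvd.trans (by norm_num) (Nat.sub_dvd_pow_sub_pow (2 ^ 4) 1 k |>.trans (by simp))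
  have hN : 0 < 2 ^ (4 * k) - 1 := by
    have := Nat.pow_le_pow_right (show 0 < 2 by norm_num) (show 1 ≤ 4 * k by omega)
    omega
  have hB1 : B ^ (5 * e) = 1 := he ▸ pow_two_pow_sub_one_eq_one hB (hL B)
  generalize 2 ^ p = P at *
  generalize 2 ^ s = q at *
  obtain ⟨c₁, hc₁⟩ : 5 ∣ P * q + 1 := by
    rw [Nat.dvd_iff_mod_eq_zero, Nat.add_mod, Nat.mul_mod, hpq]
    rcases hq with hq | hq <;> rw [hq]
  obtain ⟨c₂, hc₂⟩ : 5 ∣ P * P * P + q := by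
    rw [Nat.dvd_iff_mod_eq_zero, Nat.add_mod, Nat.mul_mod, Nat.mul_mod P P, hpq]
    rcases hq with hq | hq <;> rw [hq]
  have h1 : r ^ (P * P * q) * B ^ (5 * c₁) = B ^ (5 * c₂) * r ^ q := by
    rw [← hc₁, ← hc₂]
    linear_combination h
  have h2 := congrArg (fun x => x ^ e) h1
  simp only [mul_pow] at h2
  have hBe : ∀ c, (B ^ (5 * c)) ^ e = 1 := fun c => by
    rw [← pow_mul, mul_right_comm, pow_mul, hB1, one_pow]
  rw [hBe, hBe, mul_one, one_mul, ← pow_mul, ← pow_mul] at h2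
  obtain ⟨y, rfl⟩ : ∃ y, P = y + 1 := ⟨P - 1, by omega⟩
  have h3 : r ^ (e * (q * (y * (y + 2)))) = 1 := by
    apply mul_right_cancel₀ (pow_ne_zero (q * e) hr0)
    rw [one_mul, ← pow_add]
    refine Eq.trans ?_ h2
    congr 1
    ring
  have h4 := hr _ h3
  rw [he, mul_comm 5 e] at h4
  have h5 := Nat.dvd_of_mul_dvd_mul_left (by omega) h4
  rcases (Nat.Prime.dvd_mul Nat.prime_five).1 h5 with h | h
  · omega
  rcases (Nat.Prime.dvd_mul Nat.prime_five).1 h with h | h <;> omega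

theorem card_addSubgroup_le_four_of_div {L : Type*} [Field L] [Finite L] (K : AddSubgroup L)
    (h : ∀ u ∈ K, ∀ v ∈ K, u ≠ 0 → (v / u) ^ 4 = v / u) : Nat.card K ≤ 4 := by
  by_cases hK : ∃ u ∈ K, u ≠ 0
  · obtain ⟨u, hu, hu0⟩ := hK
    refine le_trans (Nat.card_le_card_of_injective
      (fun v : K => (⟨(v : L) / u, h u hu v v.2 hu0⟩ : {x : L // x ^ 4 = x})) ?_)
      (card_pow_four_eq_self_le L)
    intro v w hvw
    simpa [div_left_inj' hu0] using hvw
  · push Not at hK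
    rw [(AddSubgroup.eq_bot_iff_forall K).2 hK]
    simp

theorem dvd_of_pow_eq_one_of_forall_exists_pow {L : Type*} [Field L] [Fintype L]
    (hL : 2 < Fintype.card L) {t : L} (ht : ∀ y : L, y ≠ 0 → ∃ j : ℕ, y = t ^ j) :
    t ≠ 0 ∧ ∀ j, t ^ j = 1 → Fintype.card L - 1 ∣ j := by
  classical
  have ht0 : t ≠ 0 := by
    rintro rfl
    have : Nontrivial Lˣ := by
      rw [← Fintype.one_lt_card_iff_nontrivial, Fintype.card_units]
      omega
    obtain ⟨y, hy⟩ := exists_ne (1 : Lˣ)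
    obtain ⟨j, hj⟩ := ht y y.ne_zero
    rcases eq_or_ne j 0 with rfl | hj0
    · exact hy (Units.ext (by simpa using hj))
    · exact y.ne_zero (by rw [hj, zero_pow hj0])
  refine ⟨ht0, fun j hj => ?_⟩
  have hgen : ∀ y : Lˣ, y ∈ Subgroup.zpowers (Units.mk0 t ht0) := fun y => by
    obtain ⟨j, hj⟩ := ht y y.ne_zero
    exact ⟨j, Units.ext (by simp [hj])⟩
  rw [← Fintype.card_units, ← Nat.card_eq_fintype_card, ← orderOf_eq_card_of_forall_mem_zpowers hgen]
  exact orderOf_dvd_of_pow_eq_one (Units.ext (by simpa using hj))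

theorem exists_primitive_pow_eq_mul {L : Type*} [Field L] {k i : ℕ} (hi : i = 1 ∨ i = 3)
    (hL : ∀ x : L, x ^ 2 ^ (4 * k) = x) {t : L} (ht0 : t ≠ 0)
    (ht : ∀ j, t ^ j = 1 → 2 ^ (4 * k) - 1 ∣ j) :
    ∃ r : L, r ≠ 0 ∧ (∀ j, r ^ j = 1 → 2 ^ (4 * k) - 1 ∣ j) ∧
      r ^ 2 ^ (i * k) = t ^ (2 ^ k - 1) * r := by
  have hα : t ^ (2 ^ k - 1) * t = t ^ 2 ^ k := by
    rw [← pow_succ, Nat.sub_add_cancel Nat.one_le_two_pow]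
  rcases hi with rfl | rfl
  · exact ⟨t, ht0, ht, by rw [one_mul, hα]⟩
  · refine ⟨(t ^ 2 ^ k)⁻¹, inv_ne_zero (pow_ne_zero _ ht0), fun j hj => ht j ?_, ?_⟩
    · rw [inv_pow, inv_eq_one, ← pow_mul] at hj
      rw [← hL (t ^ j), ← pow_mul, show 4 * k = k + 3 * k by ring, pow_add, ← mul_assoc,
        pow_mul, mul_comm j, hj, one_pow]
    · rw [inv_pow, ← pow_mul, ← pow_add, show k + 3 * k = 4 * k by ring, hL, ← hα, mul_inv,
        ← mul_assoc, mul_inv_cancel₀ (pow_ne_zero _ ht0), one_mul]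


/-- Let `f(x) = x^{2^s+1} + α x^{2^{ik} + 2^{mk+s}}` be the binomial of Family (2) on
`L = GF(2^{4k})` (so `n = 4k`, `k ≥ 3` odd, `gcd(s,2k) = 1`, `i ∈ {1,3}` with
`i ≡ sk (mod 4)`, `m = 4 - i`, `α = t^{2^k-1}` with `t` primitive).  Then for every
`a ∈ L` and `b ∈ L^*`, the Fourier transform value
`f^W(a,b) = ∑_{x ∈ L} (-1)^{Tr(ax + b f(x))}` lies in
`{0, ±2^{n/2}, ±2^{(n+2)/2}}`, where `n = 4k`. -/
theorem stmt3 (k s : ℕ) (hk : 3 ≤ k) (hkodd : Odd k)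
    (hs : 0 < s) (hgcd : Nat.gcd s (2 * k) = 1)
    (i m : ℕ) (hi : i = 1 ∨ i = 3) (hisk : i % 4 = (s * k) % 4) (hm : m = 4 - i)
    (L : Type*) [Field L] [Fintype L] [Algebra (ZMod 2) L]
    (hcard : Fintype.card L = 2 ^ (4 * k))
    (t : L) (ht : ∀ y : L, y ≠ 0 → ∃ j : ℕ, y = t ^ j)
    (α : L) (hα : α = t ^ (2 ^ k - 1))
    (f : L → L) (hf : ∀ x, f x = x ^ (2 ^ s + 1) + α * x ^ (2 ^ (i * k) + 2 ^ (m * k + s)))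
    (a b : L) (hb : b ≠ 0)
    (W : ℤ)
    (hW : W = ∑ x : L, (-1 : ℤ) ^ (Algebra.trace (ZMod 2) L (a * x + b * f x)).val) :
    W = 0 ∨ W = 2 ^ (4 * k / 2) ∨ W = -2 ^ (4 * k / 2) ∨
      W = 2 ^ ((4 * k + 2) / 2) ∨ W = -2 ^ ((4 * k + 2) / 2) := by
  classical
  have : CharP L 2 := charP_of_injective_algebraMap (algebraMap (ZMod 2) L).injective 2
  have hL : ∀ x : L, x ^ 2 ^ (4 * k) = x := fun x => by rw [← hcard, FiniteField.pow_card]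
  have hsodd : Odd s := (Nat.Coprime.coprime_mul_right_right hgcd).symm.odd_of_left
  have hcard2 : 2 < Fintype.card L := by
    have := Nat.pow_le_pow_right (show 0 < 2 by norm_num) (show 2 ≤ 4 * k by omega)
    omega
  have hik : (i * k) % 4 = s % 4 := by
    have hkk : (k * k) % 4 = 1 := by
      rcases (by have := Nat.odd_iff.1 hkodd; omega : k % 4 = 1 ∨ k % 4 = 3) with h | h <;>
        simp [Nat.mul_mod, h]
    rw [Nat.mul_mod, hisk, ← Nat.mul_mod, mul_assoc, Nat.mul_mod, hkk, mul_one, Nat.mod_mod]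
  obtain ⟨ht0, htN⟩ := dvd_of_pow_eq_one_of_forall_exists_pow hcard2 ht
  rw [hcard] at htN
  obtain ⟨r, hr0, hrN, hrα⟩ := exists_primitive_pow_eq_mul hi hL ht0 htN
  rw [← hα] at hrα
  obtain ⟨B, rfl⟩ : ∃ B, b = r * B := ⟨b / r, (mul_div_cancel₀ b hr0).symm⟩
  have hB : B ≠ 0 := right_ne_zero_of_mul hb
  obtain ⟨σ, hσ⟩ : ∃ σ : L →+* L, ∀ x, σ x = x ^ 2 ^ s := ⟨iterateFrobenius L 2 s, fun _ => rfl⟩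
  obtain ⟨ρ, hρ⟩ : ∃ ρ : L →+* L, ∀ x, ρ x = x ^ 2 ^ (i * k) :=
    ⟨iterateFrobenius L 2 (i * k), fun _ => rfl⟩
  have hcomm : ∀ x, ρ (σ x) = σ (ρ x) := fun x => by rw [hσ, hσ, map_pow]
  have hρ4 : ∀ x, ρ (ρ (ρ (ρ x))) = x := fun x => by
    simp only [hρ, ← pow_mul, ← pow_add]
    rcases hi with rfl | rfl
    · rw [show 1 * k + 1 * k + 1 * k + 1 * k = 4 * k by ring, hL]
    · rw [show 3 * k + 3 * k + 3 * k + 3 * k = 4 * k + 4 * k + 4 * k by ring, pow_add, pow_add,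
        pow_mul, pow_mul, hL, hL, hL]
  have hσρ : ∀ x, x ^ 2 ^ (m * k + s) = σ (ρ (ρ (ρ x))) := fun x => by
    simp only [hρ, hσ, ← pow_mul, ← pow_add]
    rcases hi with rfl | rfl
    · rw [hm]
      congr 2
      ring
    · rw [hm, show 3 * k + 3 * k + 3 * k + s = 4 * k + 4 * k + (1 * k + s) by ring, pow_add _ (_ + _),
        pow_add _ (4 * k), pow_mul, pow_mul, hL, hL]
  have hσ1 : ∀ x, σ x = x → x ≠ 0 → x = 1 := fun x hx hx0 => by
    have hcop : s.gcd (4 * k) = 1 := by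
      rw [show 4 * k = 2 * (2 * k) by ring]
      exact Nat.Coprime.mul_right (Nat.Coprime.coprime_mul_right_right hgcd) hgcd
    have := pow_two_pow_gcd_eq ((hσ x).symm.trans hx) (hL x)
    rw [hcop] at this
    simpa using pow_two_pow_sub_one_eq_one hx0 this
  have hσ2 : ∀ x, σ (σ x) = x → x ^ 4 = x := fun x hx => by
    rw [hσ, hσ, ← pow_mul, ← pow_add, ← two_mul] at hx
    have := pow_two_pow_gcd_eq hx (hL x)
    rwa [show 4 * k = 2 * (2 * k) by ring, Nat.gcd_mul_left, hgcd] at this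
  have hg : ∀ x, a * x + r * B * f x
      = a * x + (r * B * (x * σ x) + ρ r * B * (ρ x * σ (ρ (ρ (ρ x))))) := fun x => by
    rw [hf, pow_add, pow_add, hσρ, ← hσ, ← hρ, hρ r, hrα]
    ring
  have hcross : ∀ x u, Algebra.trace (ZMod 2) L (a * (x + u) + r * B * f (x + u))
        + Algebra.trace (ZMod 2) L (a * x + r * B * f x)
        + Algebra.trace (ZMod 2) L (a * u + r * B * f u)
      = Algebra.trace (ZMod 2) L (r * B * (x * σ u + u * σ x)
        + ρ r * B * (ρ x * σ (ρ (ρ (ρ u))) + ρ u * σ (ρ (ρ (ρ x))))) := fun x u => by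
    rw [← map_add, ← map_add, hg, hg, hg]
    congr 1
    simp only [map_add]
    linear_combination (a * x + a * u + r * B * (x * σ x + u * σ u)
      + ρ r * B * (ρ x * σ (ρ (ρ (ρ x))) + ρ u * σ (ρ (ρ (ρ u))))) * CharTwo.two_eq_zero (R := L)
  let K : AddSubgroup L :=
    { carrier := {u | ∀ x, Algebra.trace (ZMod 2) L (r * B * (x * σ u + u * σ x)
        + ρ r * B * (ρ x * σ (ρ (ρ (ρ u))) + ρ u * σ (ρ (ρ (ρ x))))) = 0}
      zero_mem' := by simp
      add_mem' := fun {u v} hu hv x => by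
        refine Eq.trans ?_ ((congrArg₂ (· + ·) (hu x) (hv x)).trans (add_zero 0))
        simp only [map_add, mul_add, add_mul]
        ring
      neg_mem' := fun {u} hu => by rwa [CharTwo.neg_eq] }
  rw [show 4 * k / 2 = 2 * k by omega, show (4 * k + 2) / 2 = 2 * k + 1 by omega]
  refine sign_sum_spectrum _ ?_ K (fun u => ?_) (hcard.trans ?_) ?_ hW
  · intro x y z
    rw [hcross, hcross, hcross]
    simp only [map_add, mul_add, add_mul]
    ring
  · exact forall_congr' fun x => by rw [hcross]
  · ring
  · refine card_addSubgroup_le_four_of_div K fun u hu v hv hu0 => hσ2 _ ?_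
    have htrσ : ∀ x, Algebra.trace (ZMod 2) L (σ x) = Algebra.trace (ZMod 2) L x := fun x => by
      rw [hσ, trace_pow_two_pow]
    have htrρ : ∀ x, Algebra.trace (ZMod 2) L (ρ x) = Algebra.trace (ZMod 2) L x := fun x => by
      rw [hρ, trace_pow_two_pow]
    refine fixed_div_of_linearized σ ρ hcomm hρ4 hσ1 hr0 ?_ ?_ hB hu0
      (linearized_of_trace_eq_zero σ ρ hcomm hρ4 htrσ htrρ hu)
      (linearized_of_trace_eq_zero σ ρ hcomm hρ4 htrσ htrρ hv)
    · simp only [hρ, hσ]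
      exact fun D w hD hw => primitive_norm_mul_ne_one hkodd hsodd hi hL hrN hD hw
    · simp only [hρ, hσ]
      exact fun B hB => primitive_ratio_ne hsodd hik hL hr0 hrN hkodd.pos hB
end

section
/- Let f(x) = x^3 + Tr(x^9) on L = GF(2^n). Then for every a ∈ L and every b ∈ L*, the Fourier transform value f^W(a,b) lies in {0, ±2^{(n+1)/2}} when n is odd, and lies in {0, ±2^{n/2}, ±2^{(n+2)/2}} when n is even. -/
theorem ZMod.neg_one_pow_val_add (u v : ZMod 2) :
    (-1 : ℤ) ^ (u + v).val = (-1) ^ u.val * (-1) ^ v.val := by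
  revert u v; decide

/-- The character sum of an additive map to `ZMod 2`. -/
theorem sum_neg_one_pow_additive {G : Type*} [AddCommGroup G] [Fintype G] (g : G → ZMod 2)
    (hg : ∀ x y, g (x + y) = g x + g y) :
    ((∀ x, g x = 0) ∧ ∑ x, (-1 : ℤ) ^ (g x).val = Fintype.card G) ∨
      ((¬ ∀ x, g x = 0) ∧ ∑ x, (-1 : ℤ) ^ (g x).val = 0) := by
  by_cases h : ∀ x, g x = 0
  · left
    exact ⟨h, by simp [h]⟩
  · refine Or.inr ⟨h, ?_⟩
    push Not at h
    obtain ⟨c, hc⟩ := h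
    have hc1 : g c = 1 := by
      generalize g c = u at hc
      revert u; decide
    have hshift : ∑ x, (-1 : ℤ) ^ (g (x + c)).val = ∑ x, (-1 : ℤ) ^ (g x).val :=
      Fintype.sum_equiv (Equiv.addRight c) _ _ fun _ => rfl
    have hneg : ∑ x, (-1 : ℤ) ^ (g (x + c)).val = -∑ x, (-1 : ℤ) ^ (g x).val := by
      rw [← Finset.sum_neg_distrib]
      refine Finset.sum_congr rfl fun x _ => ?_
      rw [hg, hc1, ZMod.neg_one_pow_val_add]
      simp [ZMod.val_one]
    omega

/-- The squared character sum of a quadratic form over `ZMod 2` in terms of the radical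
of its polar form `B`. -/
theorem sq_sum_neg_one_pow_quadratic {G : Type*} [AddCommGroup G] [Fintype G] (Q : G → ZMod 2)
    (B : G → G → ZMod 2) (hQ : ∀ x y, Q (x + y) = Q x + Q y + B x y)
    (hB : ∀ x y z, B x (y + z) = B x y + B x z) :
    ∃ K : AddSubgroup G, (∀ d, d ∈ K ↔ ∀ y, B d y = 0) ∧
      (∑ x, (-1 : ℤ) ^ (Q x).val = 0 ∨
        (∑ x, (-1 : ℤ) ^ (Q x).val) ^ 2 = Fintype.card G * Nat.card K) := by
  classical
  have hsymm : ∀ x y, B x y = B y x := fun x y => by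
    have h₁ := hQ x y
    have h₂ := hQ y x
    rw [add_comm y x] at h₂
    linear_combination h₂ - h₁
  have hBl : ∀ x y z, B (x + y) z = B x z + B y z := fun x y z => by
    rw [hsymm, hB, hsymm z x, hsymm z y]
  have hB0 : ∀ y, B 0 y = 0 := fun y => by simpa using hBl 0 0 y
  let K : AddSubgroup G :=
    { carrier := {d | ∀ y, B d y = 0}
      zero_mem' := hB0
      add_mem' := fun {x y} hx hy z => by rw [hBl, hx z, hy z, add_zero]
      neg_mem' := fun {x} hx y => by
        have h := hBl x (-x) y
        rw [add_neg_cancel, hB0, hx y, zero_add] at h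
        exact h.symm }
  have hK : ∀ d, d ∈ K ↔ ∀ y, B d y = 0 := fun d => Iff.rfl
  refine ⟨K, hK, ?_⟩
  have hsq : (∑ x, (-1 : ℤ) ^ (Q x).val) ^ 2
      = ∑ d, (-1 : ℤ) ^ (Q d).val * ∑ x, (-1 : ℤ) ^ (B d x).val := by
    rw [sq, Finset.sum_mul]
    simp_rw [Finset.mul_sum]
    have hshift : ∀ x, ∑ y, (-1 : ℤ) ^ (Q x).val * (-1) ^ (Q y).val
        = ∑ d, (-1 : ℤ) ^ (Q x).val * (-1) ^ (Q (d + x)).val := fun x =>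
      (Fintype.sum_equiv (Equiv.addRight x) _ _ fun _ => rfl).symm
    simp_rw [hshift]
    rw [Finset.sum_comm]
    refine Finset.sum_congr rfl fun d _ => Finset.sum_congr rfl fun x _ => ?_
    rw [hQ, ← ZMod.neg_one_pow_val_add, ← ZMod.neg_one_pow_val_add]
    congr 2
    have h2 : Q x + Q x = 0 := CharTwo.add_self_eq_zero _
    linear_combination h2
  have hinner : ∀ d, ∑ x, (-1 : ℤ) ^ (B d x).val = if d ∈ K then (Fintype.card G : ℤ) else 0 := by
    intro d
    rcases sum_neg_one_pow_additive (B d) (hB d) with ⟨h, hs⟩ | ⟨h, hs⟩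
    · rw [hs, if_pos ((hK d).2 h)]
    · rw [hs, if_neg fun hd => h ((hK d).1 hd)]
  have hrad : (∑ x, (-1 : ℤ) ^ (Q x).val) ^ 2
      = Fintype.card G * ∑ d : K, (-1 : ℤ) ^ (Q d).val := by
    rw [hsq, Finset.mul_sum]
    simp_rw [hinner, mul_ite, mul_zero]
    rw [← Finset.sum_filter, Finset.sum_subtype (p := (· ∈ K)) _ (by simp)]
    exact Finset.sum_congr rfl fun _ _ => mul_comm _ _
  rcases sum_neg_one_pow_additive (fun d : K => Q d)
    (fun x y => by simp [hQ, (hK x).1 x.2]) with ⟨-, hs⟩ | ⟨-, hs⟩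
  · right
    rw [hrad, hs, Nat.card_eq_fintype_card]
  · left
    rw [hs, mul_zero] at hrad
    exact pow_eq_zero_iff two_ne_zero |>.1 hrad

/-- An additive map with values in `{0, 1}` has a kernel of index at most two. -/
theorem ncard_le_two_mul_of_additive {L : Type*} [Field L] [Finite L] [CharP L 2] {S H : Set L}
    (hS : ∀ x ∈ S, ∀ y ∈ S, x + y ∈ S) (c : L → L) (hc : ∀ x y, c (x + y) = c x + c y)
    (h01 : ∀ x ∈ S, c x = 0 ∨ c x = 1) (hH : ∀ x ∈ S, c x = 0 → x ∈ H) :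
    S.ncard ≤ 2 * H.ncard := by
  by_cases h : ∃ x₀ ∈ S, c x₀ = 1
  · obtain ⟨x₀, hx₀, hcx₀⟩ := h
    have hsub : S ⊆ H ∪ (x₀ + ·) '' H := fun x hx => by
      rcases h01 x hx with h0 | h1
      · exact Or.inl (hH x hx h0)
      · refine Or.inr ⟨x₀ + x, hH _ (hS _ hx₀ _ hx) ?_, ?_⟩
        · rw [hc, hcx₀, h1, CharTwo.add_self_eq_zero]
        · simp [← add_assoc, CharTwo.add_self_eq_zero]
    have h₁ := Set.ncard_le_ncard hsub (Set.toFinite _)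
    have h₂ := Set.ncard_union_le H ((x₀ + ·) '' H)
    have h₃ := Set.ncard_image_le (f := (x₀ + ·)) (Set.toFinite H)
    omega
  · push Not at h
    have h₁ := Set.ncard_le_ncard
      (fun x hx => hH x hx ((h01 x hx).resolve_right (h x hx)) : S ⊆ H) (Set.toFinite _)
    omega

theorem eq_zero_or_one_of_sq_add_self {L : Type*} [Field L] [CharP L 2] {x : L}
    (h : x ^ 2 + x = 0) : x = 0 ∨ x = 1 := by
  have h' : x * (x + 1) = 0 := by linear_combination h
  exact (mul_eq_zero.1 h').imp_right CharTwo.add_eq_zero.1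

theorem exists_pow_two_pow_eq {L : Type*} [Field L] [Finite L] [CharP L 2] (k : ℕ) (y : L) : ∃ z, z ^ 2 ^ k = y := by
  obtain ⟨z, hz⟩ := (bijective_iterateFrobenius L 2 k).2 y
  exact ⟨z, by rwa [iterateFrobenius_def] at hz⟩

section Trace

variable {L : Type*} [Field L] [Fintype L] [Algebra (ZMod 2) L]

theorem trace_sq (z : L) : Algebra.trace (ZMod 2) L (z ^ 2) = Algebra.trace (ZMod 2) L z := by
  have h := Algebra.trace_eq_of_algEquiv
    (FiniteField.frobeniusAlgEquivOfAlgebraic (ZMod 2) L) z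
  simpa [ZMod.card] using h

theorem trace_four_pow (z : L) :
    Algebra.trace (ZMod 2) L (z ^ 4) = Algebra.trace (ZMod 2) L z := by
  rw [show z ^ 4 = (z ^ 2) ^ 2 by ring, trace_sq, trace_sq]

theorem trace_eight_pow (z : L) :
    Algebra.trace (ZMod 2) L (z ^ 8) = Algebra.trace (ZMod 2) L z := by
  rw [show z ^ 8 = (z ^ 4) ^ 2 by ring, trace_sq, trace_four_pow]

theorem trace_four_pow_add_self (z : L) : Algebra.trace (ZMod 2) L (z ^ 4 + z) = 0 := by
  rw [map_add, trace_four_pow, CharTwo.add_self_eq_zero]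

theorem eq_zero_of_forall_trace_mul {z : L} (h : ∀ y, Algebra.trace (ZMod 2) L (z * y) = 0) :
    z = 0 :=
  (traceForm_nondegenerate (ZMod 2) L).1 z fun y => by
    rw [Algebra.traceForm_apply]; exact h y

/-- If `x` lies in the radical of `Tr(b x ^ 3)`, then `b x ^ 3 ∈ {0, 1}`. -/
theorem cubic_radical [CharP L 2] {b x : L}
    (h : ∀ y, Algebra.trace (ZMod 2) L (b * (x ^ 2 * y + x * y ^ 2)) = 0) :
    b ^ 2 * x ^ 4 + b * x = 0 := by
  refine eq_zero_of_forall_trace_mul fun y => ?_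
  obtain ⟨z, rfl⟩ := exists_pow_two_pow_eq 1 y
  have h₁ := trace_sq (b * (x ^ 2 * z))
  have h₂ := h z
  rw [mul_add, map_add, ← h₁, ← map_add] at h₂
  rw [← h₂]
  congr 1
  ring

/-- The radical of `Tr(b x ^ 3 + x ^ 9)` satisfies a linearized equation of degree 64. -/
theorem cubic_nonic_radical [CharP L 2] {b x : L}
    (h : ∀ y, Algebra.trace (ZMod 2) L
      (b * (x ^ 2 * y + x * y ^ 2) + (x ^ 8 * y + x * y ^ 8)) = 0) :
    x ^ 64 + (b ^ 4) ^ 2 * x ^ 16 + b ^ 4 * x ^ 4 + x = 0 := by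
  refine eq_zero_of_forall_trace_mul fun y => ?_
  obtain ⟨z, rfl⟩ := exists_pow_two_pow_eq 3 y
  have h₁ := trace_eight_pow (b * (x ^ 2 * z))
  have h₂ := trace_four_pow (b * (x * z ^ 2))
  have h₃ := trace_eight_pow (x ^ 8 * z)
  have h₄ := h z
  rw [mul_add, map_add, map_add, map_add, ← h₁, ← h₂, ← h₃, ← map_add, ← map_add, ← map_add] at h₄
  rw [← h₄]
  congr 1
  ring

/-- When `Tr β = 1`, a nonzero root of the degree-64 linearized polynomial satisfies an equation
of half the degree, and its inverse cube has trace one. -/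
theorem linearized_root [CharP L 2] {β x : L} (hβ : Algebra.trace (ZMod 2) L β = 1)
    (h : x ^ 64 + β ^ 2 * x ^ 16 + β * x ^ 4 + x = 0) :
    x ^ 36 + x ^ 18 + x ^ 9 + β * x ^ 12 = 0 ∧
      (x ≠ 0 → Algebra.trace (ZMod 2) L (x⁻¹ ^ 3) = 1) := by
  rcases eq_or_ne x 0 with rfl | hx
  · simp
  have hE : (x ^ 36 + x ^ 18 + x ^ 9 + β * x ^ 12) ^ 2
      + (x ^ 36 + x ^ 18 + x ^ 9 + β * x ^ 12) = 0 := by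
    have h2 : (2 : L) = 0 := CharTwo.two_eq_zero
    grind
  have htr : ∀ e : L, x ^ 36 + x ^ 18 + x ^ 9 + β * x ^ 12 = e →
      β = (x ^ 6) ^ 4 + x ^ 6 + x⁻¹ ^ 3 + e * x⁻¹ ^ 12 := fun e he => by
    subst he
    have h2 : (2 : L) = 0 := CharTwo.two_eq_zero
    field_simp
    grind
  rcases eq_zero_or_one_of_sq_add_self hE with h0 | h1
  · refine ⟨h0, fun _ => ?_⟩
    have := htr 0 h0
    rw [zero_mul, add_zero] at this
    rw [this, map_add, trace_four_pow_add_self, zero_add] at hβ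
    exact hβ
  · have := htr 1 h1
    rw [show (x ^ 6) ^ 4 + x ^ 6 + x⁻¹ ^ 3 + 1 * x⁻¹ ^ 12
      = ((x ^ 6) ^ 4 + x ^ 6) + ((x⁻¹ ^ 3) ^ 4 + x⁻¹ ^ 3) by ring] at this
    rw [this, map_add, trace_four_pow_add_self, trace_four_pow_add_self] at hβ
    simp at hβ

/-- The additive map separating the radical from a multiple of the subfield of order four. -/
theorem radical_quotient [CharP L 2] {β s τ : L} (hs : s ≠ 0)
    (htr : Algebra.trace (ZMod 2) L (s⁻¹ ^ 3) = 1)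
    (h₁ : s ^ 36 + s ^ 18 + s ^ 9 + β * s ^ 12 = 0)
    (h₂ : (s * τ) ^ 36 + (s * τ) ^ 18 + (s * τ) ^ 9 + β * (s * τ) ^ 12 = 0)
    (h₃ : (s + s * τ) ^ 36 + (s + s * τ) ^ 18 + (s + s * τ) ^ 9 + β * (s + s * τ) ^ 12 = 0) :
    ((s ^ 9) ^ 2 * (τ ^ 4 + τ) ^ 4 + s ^ 9 * (τ ^ 4 + τ) = 0 ∨
        (s ^ 9) ^ 2 * (τ ^ 4 + τ) ^ 4 + s ^ 9 * (τ ^ 4 + τ) = 1) ∧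
      ((s ^ 9) ^ 2 * (τ ^ 4 + τ) ^ 4 + s ^ 9 * (τ ^ 4 + τ) = 0 → τ ^ 4 + τ = 0) := by
  refine ⟨eq_zero_or_one_of_sq_add_self ?_, fun h => ?_⟩
  · have key : ((s ^ 9) ^ 2 * (τ ^ 4 + τ) ^ 4 + s ^ 9 * (τ ^ 4 + τ)) ^ 2
        + ((s ^ 9) ^ 2 * (τ ^ 4 + τ) ^ 4 + s ^ 9 * (τ ^ 4 + τ))
        = ((s * τ) ^ 36 + (s * τ) ^ 18 + (s * τ) ^ 9 + β * (s * τ) ^ 12)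
          + ((s + s * τ) ^ 36 + (s + s * τ) ^ 18 + (s + s * τ) ^ 9 + β * (s + s * τ) ^ 12)
          + (s ^ 36 + s ^ 18 + s ^ 9 + β * s ^ 12) * (1 + τ ^ 8 + τ ^ 4) := by
      clear h₁ h₂ h₃ htr hs
      grind
    rw [key, h₁, h₂, h₃]
    ring
  · by_contra hρ
    have hcube : (s ^ 3 * (τ ^ 4 + τ)) ^ 3 = 1 := by
      have : s ^ 9 * (τ ^ 4 + τ) * ((s ^ 3 * (τ ^ 4 + τ)) ^ 3 + 1) = 0 := by
        linear_combination h
      rcases mul_eq_zero.1 this with h' | h'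
      · simp [hs, hρ] at h'
      · exact CharTwo.add_eq_zero.1 h'
    generalize hζ : s ^ 3 * (τ ^ 4 + τ) = ζ at hcube
    have hinv : s⁻¹ ^ 3 = (ζ ^ 2 * τ) ^ 4 + ζ ^ 2 * τ := by
      field_simp
      linear_combination -(1 + τ ^ 4 * s ^ 3 * (ζ ^ 5 + ζ ^ 2)) * hcube - ζ ^ 2 * hζ
    rw [hinv, trace_four_pow_add_self] at htr
    exact zero_ne_one htr

/-- The radical of the polar form of `Tr(b (x ^ 3 + Tr(x ^ 9)))` has at most eight elements, and at
most four in odd degree. -/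
theorem radical_card_le [CharP L 2] {S : Set L} (hS : ∀ x ∈ S, ∀ y ∈ S, x + y ∈ S) {b : L}
    (hb : b ≠ 0) (h : ∀ x ∈ S, ∀ y, Algebra.trace (ZMod 2) L (b * (x ^ 2 * y + x * y ^ 2)) +
      Algebra.trace (ZMod 2) L b * Algebra.trace (ZMod 2) L (x ^ 8 * y + x * y ^ 8) = 0) :
    S.ncard ≤ 8 ∧ (Algebra.trace (ZMod 2) L 1 = 1 → S.ncard ≤ 4) := by
  by_cases hS0 : S ⊆ {0}
  · have := Set.ncard_le_ncard hS0 (Set.toFinite _)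
    rw [Set.ncard_singleton] at this
    exact ⟨by omega, fun _ => by omega⟩
  obtain ⟨s, hsS, hs⟩ := Set.not_subset.1 hS0
  replace hs : s ≠ 0 := hs
  have hadd : ∀ x y : L, (x + y) ^ 4 = x ^ 4 + y ^ 4 := fun x y => add_pow_char_pow x y 2 2
  have hsq : ∀ x y : L, (x + y) ^ 2 = x ^ 2 + y ^ 2 := CharTwo.add_sq
  set F : Set L := {x | (x / s) ^ 4 + x / s = 0} with hF
  have hline : ∀ x : L, (x / s) ^ 2 + x / s = 0 → x ∈ ({0, s} : Set L) := fun x hx => by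
    rcases eq_zero_or_one_of_sq_add_self hx with h0 | h1
    · left
      simpa [hs] using h0
    · right
      exact (div_eq_one_iff_eq hs).1 h1
  have hF01 : ∀ x ∈ F, (x / s) ^ 2 + x / s = 0 ∨ (x / s) ^ 2 + x / s = 1 := fun x hx => by
    refine eq_zero_or_one_of_sq_add_self ?_
    rw [hF, Set.mem_ofPred_eq] at hx
    have h2 : (2 : L) = 0 := CharTwo.two_eq_zero
    linear_combination hx + ((x / s) ^ 3 + (x / s) ^ 2) * h2
  have hline_card : ({0, s} : Set L).ncard = 2 := Set.ncard_pair hs.symm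
  have hF4 : F.ncard ≤ 2 * ({0, s} : Set L).ncard := by
    refine ncard_le_two_mul_of_additive ?_ (fun x => (x / s) ^ 2 + x / s) ?_ hF01
      fun x _ hx => hline x hx
    · intro x hx y hy
      rw [hF, Set.mem_ofPred_eq] at hx hy ⊢
      rw [add_div, hadd]
      linear_combination hx + hy
    · intro x y
      simp only [add_div, hsq]
      ring
  have hF2 : Algebra.trace (ZMod 2) L 1 = 1 → F.ncard ≤ ({0, s} : Set L).ncard := fun h1 => by
    refine Set.ncard_le_ncard (fun x hx => hline x ((hF01 x hx).resolve_right fun hx1 => ?_))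
      (Set.toFinite _)
    rw [← hx1, map_add, trace_sq, CharTwo.add_self_eq_zero] at h1
    exact zero_ne_one h1
  suffices hSF : S.ncard ≤ 2 * F.ncard by
    exact ⟨by omega, fun h1 => by have := hF2 h1; omega⟩
  have htb : Algebra.trace (ZMod 2) L b = 0 ∨ Algebra.trace (ZMod 2) L b = 1 := by
    generalize Algebra.trace (ZMod 2) L b = u
    revert u; decide
  rcases htb with hb0 | hb1
  · have hcube : ∀ x ∈ S, x ≠ 0 → b * x ^ 3 = 1 := fun x hx hx0 => by
      have h' := cubic_radical (b := b) (x := x) fun y => by simpa [hb0] using h x hx y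
      have h'' : b * x * (b * x ^ 3 + 1) = 0 := by linear_combination h'
      exact CharTwo.add_eq_zero.1 ((mul_eq_zero.1 h'').resolve_left (mul_ne_zero hb hx0))
    have hsub : S ⊆ F := fun x hx => by
      rw [hF, Set.mem_ofPred_eq]
      rcases eq_or_ne x 0 with rfl | hx0
      · simp
      · have h' : (x / s) ^ 3 = 1 := by
          rw [div_pow, div_eq_one_iff_eq (pow_ne_zero _ hs)]
          exact mul_left_cancel₀ hb ((hcube x hx hx0).trans (hcube s hsS hs).symm)
        rw [pow_succ, h', one_mul, CharTwo.add_self_eq_zero]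
    have := Set.ncard_le_ncard hsub (Set.toFinite _)
    omega
  · have hroot : ∀ x ∈ S, x ^ 36 + x ^ 18 + x ^ 9 + b ^ 4 * x ^ 12 = 0 ∧
        (x ≠ 0 → Algebra.trace (ZMod 2) L (x⁻¹ ^ 3) = 1) := fun x hx => by
      refine linearized_root ((trace_four_pow b).trans hb1) (cubic_nonic_radical fun y => ?_)
      rw [map_add, ← h x hx y, hb1, one_mul]
    have hquot : ∀ x ∈ S, _ := fun x hx =>
      radical_quotient (β := b ^ 4) (τ := x / s) hs ((hroot s hsS).2 hs) (hroot s hsS).1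
        (by rw [mul_div_cancel₀ _ hs]; exact (hroot x hx).1)
        (by rw [mul_div_cancel₀ _ hs]; exact (hroot _ (hS _ hsS _ hx)).1)
    refine ncard_le_two_mul_of_additive hS
      (fun x => (s ^ 9) ^ 2 * ((x / s) ^ 4 + x / s) ^ 4 + s ^ 9 * ((x / s) ^ 4 + x / s)) ?_
      (fun x hx => (hquot x hx).1) (fun x hx => (hquot x hx).2)
    intro x y
    have hρ : ((x + y) / s) ^ 4 + (x + y) / s
        = ((x / s) ^ 4 + x / s) + ((y / s) ^ 4 + y / s) := by
      rw [add_div, hadd]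
      ring
    simp only [hρ, hadd]
    ring

end Trace

/-- The polar form of `Tr(a x + b (x ^ 3 + Tr(x ^ 9)))`. -/
theorem trace_polar {L : Type*} [Field L] [Algebra (ZMod 2) L] [CharP L 2]
    (a b x y : L) (Q : L → ZMod 2)
    (hQ : ∀ x, Q x = Algebra.trace (ZMod 2) L (a * x + b * (x ^ 3 +
      algebraMap (ZMod 2) L (Algebra.trace (ZMod 2) L (x ^ 9))))) :
    Q (x + y) = Q x + Q y + (Algebra.trace (ZMod 2) L (b * (x ^ 2 * y + x * y ^ 2)) +
      Algebra.trace (ZMod 2) L b * Algebra.trace (ZMod 2) L (x ^ 8 * y + x * y ^ 8)) := by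
  have hQ' : ∀ x, Q x = Algebra.trace (ZMod 2) L (a * x + b * x ^ 3) +
      Algebra.trace (ZMod 2) L b * Algebra.trace (ZMod 2) L (x ^ 9) := fun x => by
    rw [hQ, mul_add, ← add_assoc, map_add, mul_comm b (algebraMap _ _ _), ← Algebra.smul_def,
      map_smul, smul_eq_mul, mul_comm (Algebra.trace (ZMod 2) L b)]
  have h2 : (2 : L) = 0 := CharTwo.two_eq_zero
  have h8 : (x + y) ^ 8 = x ^ 8 + y ^ 8 := add_pow_char_pow x y 2 3
  have h9 : (x + y) ^ 9 = x ^ 9 + y ^ 9 + (x ^ 8 * y + x * y ^ 8) := by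
    rw [pow_succ, h8]
    ring
  have h3 : a * (x + y) + b * (x + y) ^ 3
      = (a * x + b * x ^ 3) + (a * y + b * y ^ 3) + b * (x ^ 2 * y + x * y ^ 2) := by
    linear_combination b * (x ^ 2 * y + x * y ^ 2) * h2
  rw [hQ', hQ', hQ', h9, h3]
  simp only [map_add]
  ring

/-- An integer whose square is `2 ^ m` is, up to sign, the corresponding power of two. -/
theorem Int.eq_two_pow_of_sq {W : ℤ} {m : ℕ} (h : W ^ 2 = 2 ^ m) :
    ∃ j, m = 2 * j ∧ (W = 2 ^ j ∨ W = -2 ^ j) := by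
  have hnat : W.natAbs ^ 2 = 2 ^ m := by
    zify
    rw [sq_abs, h]
  obtain ⟨j, -, hj⟩ := (Nat.dvd_prime_pow Nat.prime_two).1 (hnat ▸ dvd_pow_self W.natAbs two_ne_zero)
  refine ⟨j, ?_, ?_⟩
  · rw [hj, ← pow_mul] at hnat
    have := Nat.pow_right_injective le_rfl hnat
    omega
  · rcases Int.natAbs_eq W with h' | h' <;> rw [hj] at h' <;> push_cast at h'
    · exact Or.inl h'
    · exact Or.inr h'


/-- Let `f(x) = x^3 + Tr(x^9)` on `L = GF(2^n)`, where `Tr : L → GF(2)` is the absolute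
trace and `Tr(x^9)` is regarded as an element of `GF(2) ⊆ L`.  Then for every
`a ∈ L` and `b ∈ L^*`, the Fourier transform value
`f^W(a,b) = ∑_{x ∈ L} (-1)^{Tr(ax + b f(x))}` lies in `{0, ±2^{(n+1)/2}}` when `n`
is odd, and in `{0, ±2^{n/2}, ±2^{(n+2)/2}}` when `n` is even. -/
theorem stmt5 (n : ℕ) (hn : 0 < n)
    (L : Type*) [Field L] [Fintype L] [Algebra (ZMod 2) L]
    (hcard : Fintype.card L = 2 ^ n)
    (f : L → L)
    (hf : ∀ x, f x = x ^ 3 + algebraMap (ZMod 2) L (Algebra.trace (ZMod 2) L (x ^ 9)))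
    (a b : L) (hb : b ≠ 0)
    (W : ℤ)
    (hW : W = ∑ x : L, (-1 : ℤ) ^ (Algebra.trace (ZMod 2) L (a * x + b * f x)).val) :
    (Odd n → W = 0 ∨ W = 2 ^ ((n + 1) / 2) ∨ W = -2 ^ ((n + 1) / 2)) ∧
    (Even n → W = 0 ∨ W = 2 ^ (n / 2) ∨ W = -2 ^ (n / 2) ∨
      W = 2 ^ ((n + 2) / 2) ∨ W = -2 ^ ((n + 2) / 2)) := by
  have : CharP L 2 := charP_of_injective_algebraMap (algebraMap (ZMod 2) L).injective 2
  have hfin : Module.finrank (ZMod 2) L = n := by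
    have h := Module.card_eq_pow_finrank (K := ZMod 2) (V := L)
    rw [hcard, ZMod.card] at h
    exact (Nat.pow_right_injective le_rfl h).symm
  obtain ⟨K, hK, hWK⟩ := sq_sum_neg_one_pow_quadratic
    (fun x => Algebra.trace (ZMod 2) L (a * x + b * f x)) _
    (fun x y => trace_polar a b x y (fun x => Algebra.trace (ZMod 2) L (a * x + b * f x))
      fun x => by rw [hf])
    (fun x y z => by
      have h8 : (y + z) ^ 8 = y ^ 8 + z ^ 8 := add_pow_char_pow y z 2 3
      rw [CharTwo.add_sq, h8]
      simp only [mul_add, map_add]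
      ring)
  rw [← hW] at hWK
  obtain ⟨hK8, hK4⟩ := radical_card_le (S := (K : Set L)) (fun x hx y hy => K.add_mem hx hy) hb
    fun x hx => (hK x).1 hx
  rcases hWK with h0 | hsq
  · exact ⟨fun _ => Or.inl h0, fun _ => Or.inl h0⟩
  have hdvd := AddSubgroup.card_addSubgroup_dvd_card K
  rw [Nat.card_eq_fintype_card (α := L), hcard] at hdvd
  obtain ⟨k, -, hk⟩ := (Nat.dvd_prime_pow Nat.prime_two).1 hdvd
  have hncard : (K : Set L).ncard = 2 ^ k := hk
  rw [hncard] at hK8 hK4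
  rw [hcard, hk] at hsq
  push_cast at hsq
  rw [← pow_add] at hsq
  obtain ⟨j, hj, hWj⟩ := Int.eq_two_pow_of_sq hsq
  have hk3 : k ≤ 3 := (Nat.pow_le_pow_iff_right (by norm_num : 1 < 2)).1 hK8
  refine ⟨fun hodd => ?_, fun heven => ?_⟩
  · have htr1 : Algebra.trace (ZMod 2) L 1 = 1 := by
      have h := Algebra.trace_algebraMap (R := ZMod 2) (S := L) 1
      rw [map_one, hfin, nsmul_one] at h
      rw [h, ZMod.natCast_eq_one_iff_odd]
      exact hodd
    have hk2 : k ≤ 2 := (Nat.pow_le_pow_iff_right (by norm_num : 1 < 2)).1 (hK4 htr1)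
    have : j = (n + 1) / 2 := by
      obtain ⟨m, rfl⟩ := hodd
      omega
    exact Or.inr (this ▸ hWj)
  · have : j = n / 2 ∨ j = (n + 2) / 2 := by
      obtain ⟨m, rfl⟩ := heven
      omega
    rcases this with rfl | rfl
    · rcases hWj with h | h <;> simp [h]
    · rcases hWj with h | h <;> simp [h]
end

section
/- Let n = 3k with k ≥ 3, gcd(k,3) = 1, and let s satisfy gcd(s,3k) = 1 and sk ≡ −1 (mod 3). Let t be a primitive element of L = GF(2^n) and α = t^{2^k−1}. Then for every b ∈ L*, the coefficient c_1 = b^{2^{−s}−2^{k}} α^{−2^k} + b^{2^{k−s}−2^{−k}} α^{2^{k−s}} is nonzero; equivalently, b^{2^{−s}+2^{−k}} ≠ α^{2^{k−s}+2^{k}} b^{2^{k−s}+2^{k}}. -/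
/-- Powers of two with exponents congruent modulo `3`, and not divisible by `3`, modulo `7`. -/
lemma two_pow_mod_seven_of_modEq_three {k m : ℕ} (hk : k % 3 ≠ 0) (hm : m % 3 = k % 3) :
    (2 : ℤ) ^ m % 7 = 2 ^ k % 7 ∧ ((2 : ℤ) ^ k % 7 = 2 ∨ (2 : ℤ) ^ k % 7 = 4) := by
  have key : ∀ j : ℕ, (2 : ℤ) ^ j % 7 = 2 ^ (j % 3) % 7 := by
    intro j
    have h : (2 : ℤ) ^ j = (2 ^ 3) ^ (j / 3) * 2 ^ (j % 3) := by
      rw [← pow_mul, ← pow_add, Nat.div_add_mod]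
    rw [h]
    have h1 : ((2 : ℤ) ^ 3) ^ (j / 3) ≡ 1 ^ (j / 3) [ZMOD 7] :=
      Int.ModEq.pow _ (by decide)
    simpa [Int.ModEq] using h1.mul_right (2 ^ (j % 3))
  rw [key m, key k, hm]
  have h3 : k % 3 = 1 ∨ k % 3 = 2 := by omega
  rcases h3 with h | h <;> rw [h] <;> norm_num

/-- In a cyclic group of order `Q ^ 3 - 1` generated by `t`, where `Q ≡ A` modulo `7` and `7`
divides `Q ^ 2 + Q + 1`, the element `t ^ ((Q - 1) * (Q * A + Q))` is not a power with exponent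
`(Q - 1) * (Q - A)`, unless `7` divides `Q * A + Q`. -/
lemma seven_dvd_of_zpow_eq_zpow {G : Type*} [Group G] {Q A : ℤ} {t b : G} (hQ : 1 < Q)
    (hord : (orderOf t : ℤ) = Q ^ 3 - 1) (hb : b ^ (Q ^ 3 - 1) = 1)
    (hQ7 : 7 ∣ Q ^ 2 + Q + 1) (hQA : 7 ∣ Q - A)
    (h : b ^ ((Q - 1) * (Q - A)) = t ^ ((Q - 1) * (Q * A + Q))) :
    7 ∣ Q * A + Q := by
  obtain ⟨e, he⟩ := hQ7
  obtain ⟨r, hr⟩ := hQA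
  have hN : Q ^ 3 - 1 = (Q - 1) * e * 7 := by linear_combination (Q - 1) * he
  have h1 : t ^ ((Q - 1) * (Q * A + Q) * e) = 1 := by
    rw [zpow_mul, ← h, ← zpow_mul,
      show (Q - 1) * (Q - A) * e = (Q ^ 3 - 1) * r by rw [hr, hN]; ring, zpow_mul, hb, one_zpow]
  have h2 := orderOf_dvd_iff_zpow_eq_one.mpr h1
  rw [hord, hN, show (Q - 1) * (Q * A + Q) * e = (Q - 1) * e * (Q * A + Q) by ring] at h2
  refine (mul_dvd_mul_iff_left ?_).mp h2
  have : e ≠ 0 := by rintro rfl; nlinarith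
  exact mul_ne_zero (by omega) this

/-- Let `n = 3k` with `k ≥ 3`, `gcd(k,3) = 1`, and let `s` satisfy `gcd(s,3k) = 1` and
`sk ≡ -1 (mod 3)`.  Let `t` be a primitive element of `L = GF(2^n)` and
`α = t^{2^k-1}`.  Then for every `b ∈ L^*` the coefficient
`c₁ = b^{2^{-s}-2^k} α^{-2^k} + b^{2^{k-s}-2^{-k}} α^{2^{k-s}}` is nonzero;
equivalently, `b^{2^{-s}+2^{-k}} ≠ α^{2^{k-s}+2^k} b^{2^{k-s}+2^k}`.
(A Frobenius index `-j` is rendered by the representative `n - j % n`, which agrees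
with it modulo `n`, hence modulo `2^n - 1` on exponents; differences of exponents
are taken in `ℤ`, acting on the nonzero element `b` via `zpow`.) -/
theorem stmt9 (k s : ℕ) (hk : 3 ≤ k) (hk3 : Nat.gcd k 3 = 1)
    (hgcd : Nat.gcd s (3 * k) = 1) (hsk : (s * k) % 3 = 2)
    (L : Type*) [Field L] [Fintype L] (hcard : Fintype.card L = 2 ^ (3 * k))
    (t : L) (ht : ∀ y : L, y ≠ 0 → ∃ j : ℕ, y = t ^ j)
    (α : L) (hα : α = t ^ (2 ^ k - 1))
    (b : L) (hb : b ≠ 0) :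
    b ^ ((2 : ℤ) ^ (3 * k - s % (3 * k)) - 2 ^ k) * α ^ (-(2 : ℤ) ^ k)
      + b ^ ((2 : ℤ) ^ (k + (3 * k - s % (3 * k))) - 2 ^ (2 * k))
        * α ^ ((2 : ℤ) ^ (k + (3 * k - s % (3 * k)))) ≠ 0 ∧
    b ^ (2 ^ (3 * k - s % (3 * k)) + 2 ^ (2 * k)) ≠
      α ^ (2 ^ (k + (3 * k - s % (3 * k))) + 2 ^ k)
        * b ^ (2 ^ (k + (3 * k - s % (3 * k))) + 2 ^ k) := by
  set m := 3 * k - s % (3 * k) with hm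
  have hk0 : k % 3 ≠ 0 := fun h ↦ by
    rw [Nat.gcd_eq_right (Nat.dvd_of_mod_eq_zero h)] at hk3
    omega
  have hmk : m % 3 = k % 3 := by
    have h1 : s % (3 * k) % 3 = s % 3 := Nat.mod_mul_right_mod s 3 k
    have h2 : s % (3 * k) < 3 * k := Nat.mod_lt _ (by omega)
    rw [Nat.mul_mod] at hsk
    have h3 : s % 3 = 0 ∨ s % 3 = 1 ∨ s % 3 = 2 := by omega
    have h4 : k % 3 = 1 ∨ k % 3 = 2 := by omega
    rcases h3 with h | h | h <;> rcases h4 with h' | h' <;> rw [h, h'] at hsk <;> omega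
  obtain ⟨hA7, hQ7⟩ := two_pow_mod_seven_of_modEq_three hk0 hmk
  have hQ1 : (1 : ℤ) < 2 ^ k := one_lt_pow₀ (by norm_num) (by omega)
  have ht0 : t ≠ 0 := by
    rintro rfl
    have hsub : ∀ y : L, y = 0 ∨ y = 1 := fun y ↦ by
      by_cases hy : y = 0
      · exact Or.inl hy
      · obtain ⟨j, rfl⟩ := ht y hy
        rcases j with _ | j
        · simp
        · simp at hy
    classical
    have hle : Fintype.card L ≤ ({0, 1} : Finset L).card := by
      rw [← Finset.card_univ]
      exact Finset.card_le_card fun y _ ↦ by simpa using hsub y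
    have h2 : ({0, 1} : Finset L).card ≤ 2 := Finset.card_le_two
    have h3 : 2 ^ 2 ≤ 2 ^ (3 * k) := Nat.pow_le_pow_right (by norm_num) (by omega)
    omega
  have hcardZ : ((Fintype.card L - 1 : ℕ) : ℤ) = (2 ^ k) ^ 3 - 1 := by
    rw [hcard, Nat.cast_sub Nat.one_le_two_pow, ← pow_mul, mul_comm k 3]
    push_cast
    ring
  have hord : (orderOf (Units.mk0 t ht0) : ℤ) = (2 ^ k) ^ 3 - 1 := by
    classical
    rw [orderOf_eq_card_of_forall_mem_zpowers, Nat.card_eq_fintype_card, Fintype.card_units,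
      hcardZ]
    intro y
    obtain ⟨j, hj⟩ := ht y y.ne_zero
    exact ⟨j, Units.ext (by simpa using hj.symm)⟩
  have hbN : (Units.mk0 b hb) ^ (((2 : ℤ) ^ k) ^ 3 - 1) = 1 := by
    rw [← hcardZ, zpow_natCast]
    exact Units.ext (by simpa using FiniteField.pow_card_sub_one_eq_one b hb)
  have hα0 : α ≠ 0 := hα ▸ pow_ne_zero _ ht0
  have hαz : α = t ^ ((2 : ℤ) ^ k - 1) := by
    rw [hα, ← zpow_natCast, Nat.cast_sub Nat.one_le_two_pow]
    push_cast
    rfl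
  have hne : b ^ (2 ^ m + 2 ^ (2 * k)) ≠ α ^ (2 ^ (k + m) + 2 ^ k) * b ^ (2 ^ (k + m) + 2 ^ k) := by
    intro h
    have hz : b ^ (((2 : ℤ) ^ k - 1) * (2 ^ k - 2 ^ m)) =
        t ^ (((2 : ℤ) ^ k - 1) * (2 ^ k * 2 ^ m + 2 ^ k)) := by
      rw [zpow_mul t, ← hαz, show ((2 : ℤ) ^ k - 1) * (2 ^ k - 2 ^ m) =
        ((2 ^ m + 2 ^ (2 * k) : ℕ) : ℤ) - ((2 ^ (k + m) + 2 ^ k : ℕ) : ℤ) by push_cast; ring,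
        show (2 : ℤ) ^ k * 2 ^ m + 2 ^ k = ((2 ^ (k + m) + 2 ^ k : ℕ) : ℤ) by push_cast; ring,
        zpow_sub₀ hb, zpow_natCast, zpow_natCast, zpow_natCast, h,
        mul_div_cancel_right₀ _ (pow_ne_zero _ hb)]
    have h7 := seven_dvd_of_zpow_eq_zpow (t := Units.mk0 t ht0) (b := Units.mk0 b hb)
      (A := 2 ^ m) hQ1 hord hbN
      (by
        have : ((2 : ℤ) ^ k) ^ 2 ≡ ((2 : ℤ) ^ k % 7) ^ 2 [ZMOD 7] := (Int.mod_modEq _ _).symm.pow 2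
        rcases hQ7 with h' | h' <;> rw [h', Int.ModEq] at this <;> omega)
      (by omega) (Units.ext (by simpa using hz))
    have h8 : (2 : ℤ) ^ k * 2 ^ m ≡ (2 ^ k % 7) * (2 ^ m % 7) [ZMOD 7] :=
      (Int.mod_modEq _ _).symm.mul (Int.mod_modEq _ _).symm
    rw [hA7] at h8
    rcases hQ7 with h' | h' <;> rw [h', Int.ModEq] at h8 <;> omega
  refine ⟨fun h ↦ hne ?_, hne⟩
  have h2 : (2 : L) = 0 := by
    have h' : ((Fintype.card L : ℕ) : L) = 0 := Nat.cast_card_eq_zero L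
    rw [hcard] at h'
    push_cast at h'
    exact eq_zero_of_pow_eq_zero h'
  have hmul := congrArg (· * (b ^ ((2 : ℤ) ^ k + 2 ^ (2 * k)) * α ^ ((2 : ℤ) ^ k))) h
  simp only [zero_mul, add_mul] at hmul
  have hb1 : b ^ ((2 : ℤ) ^ m - 2 ^ k) * α ^ (-(2 : ℤ) ^ k) *
      (b ^ ((2 : ℤ) ^ k + 2 ^ (2 * k)) * α ^ ((2 : ℤ) ^ k)) = b ^ (2 ^ m + 2 ^ (2 * k)) := by
    rw [mul_mul_mul_comm, ← zpow_add₀ hb, ← zpow_add₀ hα0, neg_add_cancel, zpow_zero, mul_one,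
      ← zpow_natCast]
    congr 1
    push_cast
    ring
  have hb2 : b ^ ((2 : ℤ) ^ (k + m) - 2 ^ (2 * k)) * α ^ ((2 : ℤ) ^ (k + m)) *
      (b ^ ((2 : ℤ) ^ k + 2 ^ (2 * k)) * α ^ ((2 : ℤ) ^ k)) =
      α ^ (2 ^ (k + m) + 2 ^ k) * b ^ (2 ^ (k + m) + 2 ^ k) := by
    rw [mul_mul_mul_comm, ← zpow_add₀ hb, ← zpow_add₀ hα0, mul_comm, ← zpow_natCast,
      ← zpow_natCast]
    congr 2
    push_cast
    ring
  rw [hb1, hb2] at hmul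
  linear_combination hmul - α ^ (2 ^ (k + m) + 2 ^ k) * b ^ (2 ^ (k + m) + 2 ^ k) * h2
end

section
/- Let n = 3k with k ≥ 3, gcd(k,3) = 1, and let s satisfy gcd(s,3k) = 1 and sk ≡ −1 (mod 3). Let t be a primitive element of L = GF(2^n) and α = t^{2^k−1}. Then for every b ∈ L*, the equation L_b(u) = b u^{2^s} + (b u)^{2^{−s}} + (bα)^{2^k} u^{2^{−k+s}} + (bα)^{2^{−k−s}} u^{2^{k−s}} = 0 has at most 4 solutions u ∈ L. -/
/-- Two nonzero solutions of the twisted equation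
`σ (c t σ(u) - θ(c) θ²(t) σθ²(u)) + t (c u - θ²(c) θ(u)) = 0`, where `θ³ = 1`, differ by a factor
fixed by `θ` and `σ²`, provided a valuation-like map `ℓ` on which `θ` acts as `Q`, and `σ` as `Q²`,
with `Q` a primitive cube root of unity, does not vanish at `t`. -/
theorem ratio_fixed_of_twisted_eq {L F : Type*} [Field L] [Field F] (θ σ : L →+* L)
    (hθ : ∀ x, θ (θ (θ x)) = x) (hcomm : ∀ x, θ (σ x) = σ (θ x))
    (l : L → F) (hl : ∀ x y, x ≠ 0 → y ≠ 0 → l (x * y) = l x + l y)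
    (Q : F) (hQ : Q ^ 2 + Q + 1 = 0) (h2 : (2 : F) ≠ 0) (h3 : (3 : F) ≠ 0)
    (hlθ : ∀ x, x ≠ 0 → l (θ x) = Q * l x) (hlσ : ∀ x, x ≠ 0 → l (σ x) = Q ^ 2 * l x)
    {c t : L} (hc : c ≠ 0) (ht : t ≠ 0) (hlt : l t ≠ 0) {u v : L} (hu : u ≠ 0)
    (Eu : σ (c * t * σ u - θ c * θ (θ t) * σ (θ (θ u))) + t * (c * u - θ (θ c) * θ u) = 0)
    (Ev : σ (c * t * σ v - θ c * θ (θ t) * σ (θ (θ v))) + t * (c * v - θ (θ c) * θ v) = 0) :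
    θ (v / u) = v / u ∧ σ (σ (v / u)) = v / u := by
  have hθ0 : ∀ x, x ≠ 0 → θ x ≠ 0 := fun x hx => (map_ne_zero θ).2 hx
  have hσ0 : ∀ x, x ≠ 0 → σ x ≠ 0 := fun x hx => (map_ne_zero σ).2 hx
  have hQ3 : Q ^ 3 = 1 := by linear_combination (Q - 1) * hQ
  have hQ0 : Q ≠ 0 := by rintro rfl; simp at hQ3
  have hQ1 : Q - 1 ≠ 0 := by
    intro h
    exact h3 (by linear_combination hQ - (Q + 2) * h)
  obtain ⟨g, hg⟩ : ∃ g, g = σ (θ (θ c)) * t * c - σ (θ c) * θ (θ t) * θ c := ⟨_, rfl⟩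
  have hg0 : g ≠ 0 := by
    intro h
    rw [hg, sub_eq_zero] at h
    have h' := congrArg l h
    simp only [hl, hlθ, hlσ, hc, ht, ne_eq, mul_eq_zero, map_eq_zero, or_self, not_false_eq_true] at h'
    have : (Q - 1) * l t = 0 := by
      linear_combination Q * h' + (l t - Q * (Q - 1) * l c) * hQ3
    exact mul_ne_zero hQ1 hlt this
  have hg1 : θ g = σ c * θ t * θ c - σ (θ (θ c)) * t * θ (θ c) := by
    simp only [hg, map_sub, map_mul, hcomm, hθ]
  have hg2 : θ (θ g) = σ (θ c) * θ (θ t) * θ (θ c) - σ c * θ t * c := by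
    simp only [hg1, map_sub, map_mul, hcomm, hθ]
  -- the two relations linear over the fixed field of `θ`
  have key : ∀ w,
      σ (c * t * σ w - θ c * θ (θ t) * σ (θ (θ w))) + t * (c * w - θ (θ c) * θ w) = 0 →
      (g * w + θ g * θ w + θ (θ g) * θ (θ w) = 0) ∧
      (θ (θ t) * σ t * θ g) * σ (σ w) + (t * σ (θ t) * θ (θ g)) * σ (σ (θ w)) +
        (θ t * σ (θ (θ t)) * g) * σ (σ (θ (θ w))) = 0 := by
    intro w E0
    have E1 := congrArg θ E0
    have E2 := congrArg θ E1
    simp only [map_add, map_sub, map_mul, map_zero, hcomm, hθ] at E0 E1 E2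
    rw [hg2, hg1, hg]
    constructor
    · linear_combination σ (θ (θ c)) * E0 + σ c * E1 + σ (θ c) * E2
    · linear_combination θ c * θ t * θ (θ t) * E0 + θ (θ c) * t * θ (θ t) * E1 + c * t * θ t * E2
  have indep : σ (σ g) * (θ t * σ (θ (θ t)) * g) ≠ σ (σ (θ (θ g))) * (θ (θ t) * σ t * θ g) := by
    intro h
    have h' := congrArg l h
    simp only [hl, hlθ, hlσ, hg0, ht, ne_eq, mul_eq_zero, map_eq_zero, or_self, not_false_eq_true] at h'
    have : 2 * Q * (Q - 1) * l t = 0 := by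
      linear_combination -h' + (Q * l g - (Q ^ 3 + 1) * l g + Q * l t) * hQ3
    exact mul_ne_zero (mul_ne_zero (mul_ne_zero h2 hQ0) hQ1) hlt this
  obtain ⟨ru, su⟩ := key u Eu
  obtain ⟨rv, sv⟩ := key v Ev
  have ru' := congrArg (fun x => σ (σ x)) ru
  have rv' := congrArg (fun x => σ (σ x)) rv
  simp only [map_add, map_mul, map_zero] at ru' rv'
  have hdet : σ (σ (u * θ v - θ u * v)) = 0 := by
    refine (mul_eq_zero.1 ?_).resolve_right (sub_ne_zero.2 indep)
    simp only [map_sub, map_mul]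
    linear_combination
      σ (σ (θ v)) * (θ t * σ (θ (θ t)) * g * ru' - σ (σ (θ (θ g))) * su)
        - σ (σ (θ u)) * (θ t * σ (θ (θ t)) * g * rv' - σ (σ (θ (θ g))) * sv)
  have hdet' : u * θ v - θ u * v = 0 := by
    by_contra h
    exact hσ0 _ (hσ0 _ h) hdet
  have hfix : θ (v / u) = v / u := by
    rw [map_div₀, div_eq_div_iff (hθ0 u hu) hu]
    linear_combination hdet'
  refine ⟨hfix, ?_⟩
  obtain ⟨r, hr⟩ : ∃ r, r = v / u := ⟨_, rfl⟩
  rw [← hr] at hfix ⊢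
  have hv : v = r * u := by rw [hr, div_mul_cancel₀ v hu]
  rw [hv] at Ev
  simp only [map_mul, hfix] at Ev
  have hA : σ (c * t * σ u - θ c * θ (θ t) * σ (θ (θ u))) ≠ 0 := by
    intro hA
    have hB : c * u - θ (θ c) * θ u = 0 := by
      rw [hA, zero_add] at Eu
      exact (mul_eq_zero.1 Eu).resolve_left ht
    have hA' : c * t * σ u - θ c * θ (θ t) * σ (θ (θ u)) = 0 := (map_eq_zero σ).1 hA
    rw [sub_eq_zero] at hA' hB
    have h1 := congrArg l hA'
    have h2 := congrArg l hB
    simp only [hl, hlθ, hlσ, hc, ht, hu, ne_eq, mul_eq_zero, map_eq_zero, or_self, not_false_eq_true] at h1 h2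
    have : (Q - 1) * l t = 0 := by
      linear_combination Q * h1 + Q ^ 2 * h2 + (l t + Q * (l c + Q * l u)) * hQ3
    exact mul_ne_zero hQ1 hlt this
  have : σ (c * t * σ u - θ c * θ (θ t) * σ (θ (θ u))) * (σ (σ r) - r) = 0 := by
    simp only [map_sub, map_mul] at Ev Eu ⊢
    linear_combination Ev - r * Eu
  exact sub_eq_zero.1 ((mul_eq_zero.1 this).resolve_left hA)

/-- The discrete logarithm to a primitive base, reduced modulo a divisor `m` of the order of the
multiplicative group. -/
theorem exists_log_of_primitive {L : Type*} [Field L] [Fintype L] {t : L} (ht0 : t ≠ 0)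
    (ht : ∀ y : L, y ≠ 0 → ∃ j : ℕ, y = t ^ j) {m : ℕ} (hm : m ∣ Fintype.card L - 1) :
    ∃ l : L → ZMod m, (∀ x y, x ≠ 0 → y ≠ 0 → l (x * y) = l x + l y) ∧ l t = 1 := by
  classical
  have hord : orderOf (Units.mk0 t ht0) = Fintype.card L - 1 := by
    rw [← Fintype.card_units, ← Nat.card_eq_fintype_card]
    refine orderOf_eq_card_of_forall_mem_zpowers fun y => ?_
    obtain ⟨j, hj⟩ := ht y y.ne_zero
    exact ⟨j, by ext; simp [hj]⟩
  choose! f hf using ht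
  have hcast : ∀ i j : ℕ, t ^ i = t ^ j → (i : ZMod m) = j := by
    intro i j h
    refine (ZMod.natCast_eq_natCast_iff i j m).2 (Nat.ModEq.of_dvd hm ?_)
    rw [← hord, ← pow_eq_pow_iff_modEq]
    ext
    simpa using h
  refine ⟨fun y => (f y : ZMod m), fun x y hx hy => ?_, ?_⟩
  · rw [← Nat.cast_add]
    apply hcast
    rw [pow_add, ← hf x hx, ← hf y hy, ← hf _ (mul_ne_zero hx hy)]
  · rw [← Nat.cast_one]
    apply hcast
    rw [← hf t ht0, pow_one]

theorem log_pow_of_log_mul {L R : Type*} [Field L] [Ring R] {l : L → R}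
    (hl : ∀ x y, x ≠ 0 → y ≠ 0 → l (x * y) = l x + l y) {x : L} (hx : x ≠ 0) (m : ℕ) :
    l (x ^ m) = m * l x := by
  induction m with
  | zero => simpa using hl 1 1 one_ne_zero one_ne_zero
  | succ m ih => rw [pow_succ, hl _ _ (pow_ne_zero m hx) hx, ih, Nat.cast_succ, add_mul, one_mul]

theorem ncard_pow_four_eq_self_le (L : Type*) [Field L] : {r : L | r ^ 4 = r}.ncard ≤ 4 := by
  classical
  have hdeg : (Polynomial.X ^ 4 - Polynomial.X : Polynomial L).natDegree = 4 := by compute_degree!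
  have hne : (Polynomial.X ^ 4 - Polynomial.X : Polynomial L) ≠ 0 := by
    intro h
    simp [h] at hdeg
  have : {r : L | r ^ 4 = r} ⊆
      ((Polynomial.X ^ 4 - Polynomial.X : Polynomial L).roots.toFinset : Set L) := by
    intro r hr
    simp only [Finset.mem_coe, Multiset.mem_toFinset, Polynomial.mem_roots hne,
      Polynomial.IsRoot.def, Polynomial.eval_sub, Polynomial.eval_pow, Polynomial.eval_X]
    exact sub_eq_zero.2 hr
  calc _ ≤ _ := Set.ncard_le_ncard this (Finset.finite_toSet _)
    _ = _ := Set.ncard_coe_finset _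
    _ ≤ _ := Multiset.toFinset_card_le _
    _ ≤ _ := Polynomial.card_roots' _
    _ = 4 := hdeg

theorem pow_four_eq_self_of_pow_two_pow {L : Type*} [Field L] [CharP L 2] {m n : ℕ}
    (hmn : Nat.gcd m n ∣ 2) {r : L} (hm : r ^ 2 ^ m = r) (hn : r ^ 2 ^ n = r) : r ^ 4 = r := by
  have per : ∀ j, Function.IsPeriodicPt (frobenius L 2) j r ↔ r ^ 2 ^ j = r := fun j => by
    rw [Function.IsPeriodicPt, Function.IsFixedPt, iterate_frobenius]
  exact (per 2).1 ((((per m).2 hm).gcd ((per n).2 hn)).trans_dvd hmn)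

instance fact_prime_seven : Fact (Nat.Prime 7) := ⟨by norm_num⟩

/-- Let `n = 3k` with `k ≥ 3`, `gcd(k,3) = 1`, and let `s` satisfy `gcd(s,3k) = 1` and
`sk ≡ -1 (mod 3)`.  Let `t` be a primitive element of `L = GF(2^n)` and
`α = t^{2^k-1}`.  Then for every `b ∈ L^*`, the equation
`L_b(u) = b u^{2^s} + (bu)^{2^{-s}} + (bα)^{2^k} u^{2^{-k+s}} + (bα)^{2^{-k-s}} u^{2^{k-s}} = 0`
has at most 4 solutions `u ∈ L`.
(A Frobenius index `-j` is rendered by the representative `n - j % n`, which agrees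
with it modulo `n`, hence modulo `2^n - 1` on exponents.) -/
theorem stmt10 (k s : ℕ) (hk : 3 ≤ k) (hk3 : Nat.gcd k 3 = 1)
    (hgcd : Nat.gcd s (3 * k) = 1) (hsk : (s * k) % 3 = 2)
    (L : Type*) [Field L] [Fintype L] (hcard : Fintype.card L = 2 ^ (3 * k))
    (t : L) (ht : ∀ y : L, y ≠ 0 → ∃ j : ℕ, y = t ^ j)
    (α : L) (hα : α = t ^ (2 ^ k - 1))
    (b : L) (hb : b ≠ 0) :
    {u : L |
        b * u ^ (2 ^ s) + (b * u) ^ (2 ^ (3 * k - s % (3 * k)))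
          + (b * α) ^ (2 ^ k) * u ^ (2 ^ (2 * k + s))
          + (b * α) ^ (2 ^ (2 * k + (3 * k - s % (3 * k))))
            * u ^ (2 ^ (k + (3 * k - s % (3 * k)))) = 0}.ncard ≤ 4 := by
  have : Fact (Nat.Prime 2) := ⟨Nat.prime_two⟩
  have : CharP L 2 := charP_of_card_eq_prime_pow hcard
  have hfrob : ∀ x : L, x ^ 2 ^ (3 * k) = x := fun x => hcard ▸ FiniteField.pow_card x
  have ht0 : t ≠ 0 := by
    rintro rfl
    have hle : Fintype.card L ≤ 2 := by
      classical
      refine (Finset.card_le_card (t := {0, 1}) fun y _ => ?_).trans Finset.card_le_two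
      by_cases hy : y = 0
      · simp [hy]
      · obtain ⟨j, rfl⟩ := ht y hy
        rcases j with _ | j <;> simp
    have : 2 ^ 9 ≤ 2 ^ (3 * k) := Nat.pow_le_pow_right (by norm_num) (by omega)
    omega
  have h7 : 7 ∣ Fintype.card L - 1 := by
    rw [hcard, pow_mul]
    simpa using Nat.sub_dvd_pow_sub_pow 8 1 k
  obtain ⟨l, hl, hlt⟩ := exists_log_of_primitive ht0 ht h7
  have hcase : k % 3 = 1 ∧ s % 3 = 2 ∨ k % 3 = 2 ∧ s % 3 = 1 := by
    rw [Nat.mul_mod] at hsk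
    have h1 : k % 3 < 3 := Nat.mod_lt _ (by norm_num)
    have h2 : s % 3 < 3 := Nat.mod_lt _ (by norm_num)
    interval_cases k % 3 <;> interval_cases s % 3 <;> simp_all
  have h8 : (2 : ZMod 7) ^ 3 = 1 := by decide
  have hQ : ((2 : ZMod 7) ^ k) ^ 2 + 2 ^ k + 1 = 0 := by
    rw [pow_eq_pow_mod k h8]
    rcases hcase with h | h <;> rw [h.1] <;> decide
  have hQs : (2 : ZMod 7) ^ s = (2 ^ k) ^ 2 := by
    rw [pow_eq_pow_mod k h8, pow_eq_pow_mod s h8]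
    rcases hcase with h | h <;> rw [h.1, h.2] <;> decide
  have hθ : ∀ x : L, ((x ^ 2 ^ k) ^ 2 ^ k) ^ 2 ^ k = x := fun x => by
    rw [← pow_mul, ← pow_mul, ← pow_add, ← pow_add,
      show k + (k + k) = 3 * k by ring, hfrob]
  set r := 3 * k - s % (3 * k) with hr
  have hρ : ∀ x : L, (x ^ 2 ^ r) ^ 2 ^ s = x := fun x => by
    have hrs : r + s = 3 * k * (1 + s / (3 * k)) := by
      have := Nat.mod_add_div s (3 * k)
      have := (Nat.mod_lt s (show 0 < 3 * k by omega)).le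
      rw [mul_add]
      omega
    have : ∀ j, x ^ 2 ^ (3 * k * j) = x := fun j => by
      induction j with
      | zero => simp
      | succ j ih => rw [mul_add, pow_add, pow_mul, ih, mul_one, hfrob]
    rw [← pow_mul, ← pow_add, hrs, this]
  obtain ⟨c, rfl⟩ : ∃ c, b = c * t := ⟨b / t, (div_mul_cancel₀ b ht0).symm⟩
  have hc : c ≠ 0 := left_ne_zero_of_mul hb
  have hα' : c * t * α = c * t ^ 2 ^ k := by
    rw [hα, mul_assoc, ← pow_succ', Nat.sub_add_cancel Nat.one_le_two_pow]
  let θ := iterateFrobenius L 2 k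
  let σ := iterateFrobenius L 2 s
  have hθd : ∀ x, θ x = x ^ 2 ^ k := fun x => iterateFrobenius_def 2 k x
  have hσd : ∀ x, σ x = x ^ 2 ^ s := fun x => iterateFrobenius_def 2 s x
  have two : (2 : L) = 0 := CharTwo.two_eq_zero
  have key : ∀ u : L, c * t * u ^ 2 ^ s + (c * t * u) ^ 2 ^ r
        + (c * t * α) ^ 2 ^ k * u ^ 2 ^ (2 * k + s)
        + (c * t * α) ^ 2 ^ (2 * k + r) * u ^ 2 ^ (k + r) = 0 →
      σ (c * t * σ u - θ c * θ (θ t) * σ (θ (θ u))) + t * (c * u - θ (θ c) * θ u) = 0 := by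
    intro u hu
    have e1 : ∀ x : L, x ^ 2 ^ (2 * k + r) = ((x ^ 2 ^ k) ^ 2 ^ k) ^ 2 ^ r := fun x => by
      rw [← pow_mul, ← pow_mul, ← pow_add, ← pow_add, two_mul, add_assoc]
    have e2 : u ^ 2 ^ (2 * k + s) = ((u ^ 2 ^ k) ^ 2 ^ k) ^ 2 ^ s := by
      rw [← pow_mul, ← pow_mul, ← pow_add, ← pow_add, two_mul, add_assoc]
    have e3 : u ^ 2 ^ (k + r) = (u ^ 2 ^ k) ^ 2 ^ r := by rw [← pow_mul, ← pow_add]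
    rw [hα', e1, e2, e3] at hu
    have h := congrArg σ hu
    simp only [mul_pow, map_add, map_mul, map_zero] at h
    simp only [hσd, hρ, hθ] at h
    simp only [map_sub, map_mul]
    simp only [hθd, hσd]
    linear_combination h - (((c ^ 2 ^ k) ^ 2 ^ s * ((t ^ 2 ^ k) ^ 2 ^ k) ^ 2 ^ s *
      (((u ^ 2 ^ k) ^ 2 ^ k) ^ 2 ^ s) ^ 2 ^ s) + t * (c ^ 2 ^ k) ^ 2 ^ k * u ^ 2 ^ k) * two
  by_cases hex : ∃ u : L, u ≠ 0 ∧ c * t * u ^ 2 ^ s + (c * t * u) ^ 2 ^ r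
        + (c * t * α) ^ 2 ^ k * u ^ 2 ^ (2 * k + s)
        + (c * t * α) ^ 2 ^ (2 * k + r) * u ^ 2 ^ (k + r) = 0
  · obtain ⟨u, hu0, hu⟩ := hex
    refine le_trans (Set.ncard_le_ncard (t := (fun x => x * u) '' {x : L | x ^ 4 = x}) ?_
      (Set.toFinite _)) ((Set.ncard_image_le (Set.toFinite _)).trans
        (ncard_pow_four_eq_self_le L))
    intro v hv
    refine ⟨v / u, ?_, div_mul_cancel₀ v hu0⟩
    have hfix := (ratio_fixed_of_twisted_eq θ σ (fun x => by simp only [hθd, hθ])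
      (fun x => by simp only [hθd, hσd, ← pow_mul, mul_comm]) l hl (2 ^ k) hQ (by decide)
      (by decide) (fun x hx => by rw [hθd, log_pow_of_log_mul hl hx]; push_cast; rfl)
      (fun x hx => by rw [hσd, log_pow_of_log_mul hl hx, ← hQs]; push_cast; rfl)
      hc ht0 (by rw [hlt]; decide) hu0 (key u hu) (key v hv)).2
    refine pow_four_eq_self_of_pow_two_pow (m := s + s) (n := 3 * k) ?_ ?_ (hfrob _)
    · rw [← two_mul, Nat.Coprime.gcd_mul_right_cancel 2 hgcd]
      exact Nat.gcd_dvd_left _ _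
    · simpa only [hσd, ← pow_mul, ← pow_add] using hfix
  · refine le_trans (Set.ncard_le_ncard (t := {0}) ?_ (Set.toFinite _)) (by simp)
    intro v hv
    by_contra h0
    exact hex ⟨v, h0, hv⟩
end

section
/- Let n = 4k with k ≥ 3 odd, and let s satisfy gcd(s,2k) = 1 and sk ≡ −1 (mod 4). Let t be a primitive element of L = GF(2^n) and α = t^{2^k−1}. Then for every b ∈ L*, the equation L_b(u) = b u^{2^s} + (b u)^{2^{−s}} + (bα)^{2^{k}} u^{2^{2k+s}} + (bα)^{2^{−k−s}} u^{2^{2k−s}} = 0 has at most 4 solutions u ∈ L. -/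
/-- A subset of a field that is a union of multiples `r * u` of each of its nonzero members `u`,
with `r` in a fixed finite set, is no larger than that set. -/
theorem ncard_le_of_ratio_mem {L : Type*} [Field L] [Finite L] {S R : Set L} (hR : 1 ≤ R.ncard)
    (h : ∀ u ∈ S, u ≠ 0 → ∀ v ∈ S, ∃ r ∈ R, v = r * u) : S.ncard ≤ R.ncard := by
  by_cases hS : ∃ u ∈ S, u ≠ 0
  · obtain ⟨u, hu, hu0⟩ := hS
    have hsub : S ⊆ (fun r => r * u) '' R := by
      intro v hv
      obtain ⟨r, hr, rfl⟩ := h u hu hu0 v hv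
      exact ⟨r, hr, rfl⟩
    exact (Set.ncard_le_ncard hsub (Set.toFinite _)).trans (Set.ncard_image_le (Set.toFinite _))
  · push Not at hS
    have hsub : S ⊆ {0} := fun v hv => hS v hv
    exact (Set.ncard_le_ncard hsub (Set.toFinite _)).trans (by simpa using hR)

/-- Hilbert 90 for an involution of a field of characteristic two. -/
theorem exists_ratio_of_involution {L : Type*} [Field L] [CharP L 2] (θ : L →+* L)
    (hθ : ∀ x, θ (θ x) = x) {β : L} (hβ : β * θ β = 1) : ∃ g ≠ 0, θ g = β * g := by
  by_cases h1 : β = 1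
  · exact ⟨1, one_ne_zero, by simp [h1]⟩
  · refine ⟨1 + θ β, fun h => h1 ?_, ?_⟩
    · rw [CharTwo.add_eq_zero] at h
      simpa [← h] using hβ
    · rw [map_add, map_one, hθ]
      linear_combination -hβ

section Kernel

variable {L : Type*} [Field L] [CharP L 2] (σ σi φ : L →+* L)

/-- If `D = N(b) + N(φ(bα))`, with `N` the norm to the fixed field of `φ²`, is nonzero, then any
two nonzero kernel elements differ by a factor fixed by `σ²`. -/
theorem ratio_fixed_of_ne_zero
    (hσi : ∀ x, σ (σi x) = x) (hφ4 : ∀ x, φ (φ (φ (φ x))) = x) (hcomm : ∀ x, σ (φ x) = φ (σ x))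
    (hfix : ∀ x, σ x = x → x = 0 ∨ x = 1)
    {t : L} (ht : t ≠ 0)
    (hcube : ∀ W d, φ (φ W) = W → φ d = d → t * φ (φ t) * d * (W * σ W) ≠ 1)
    {b c : L} (hc : c * t = b * φ t) (hD : b * φ (φ b) + φ c * φ (φ (φ c)) ≠ 0)
    {u v : L} (hu0 : u ≠ 0)
    (hu : b * σ u + φ c * φ (φ (σ u)) = σi (b * u + φ (φ (φ c)) * φ (φ u)))
    (hv : b * σ v + φ c * φ (φ (σ v)) = σi (b * v + φ (φ (φ c)) * φ (φ v))) :
    ∃ r, σ (σ r) = r ∧ v = r * u := by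
  have hu' := congrArg σ hu
  have hv' := congrArg σ hv
  have hu'' := congrArg φ (congrArg φ hu')
  have hv'' := congrArg φ (congrArg φ hv')
  simp only [hσi, map_add, map_mul, hcomm, hφ4] at hu' hv' hu'' hv''
  set D := b * φ (φ b) + φ c * φ (φ (φ c)) with hDdef
  set W := u * φ (φ v) + v * φ (φ u) with hWdef
  have hW : σ D * σ (σ W) = D * W := by
    have e1 := congrArg₂ (· * ·) hu' hv''
    have e2 := congrArg₂ (· * ·) hv' hu''
    simp only [hDdef, hWdef, map_add, map_mul, hcomm] at e1 e2 ⊢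
    grind
  have hT0 : t * φ (φ t) ≠ 0 := by simp [ht]
  have hφφt : φ (φ t) ≠ 0 := by simp [ht]
  have hD1 : t * φ (φ t) * (D / (t * φ (φ t))) = D := by field_simp
  have hDφ : φ (D / (t * φ (φ t))) = D / (t * φ (φ t)) := by
    have hc1 := congrArg φ hc
    have hc2 := congrArg φ hc1
    have hc3 := congrArg φ hc2
    simp only [map_mul, hφ4] at hc1 hc2 hc3
    rw [map_div₀, div_eq_div_iff (by simp [ht]) hT0]
    simp only [hDdef, map_add, map_mul, hφ4]
    have e1 := congrArg₂ (· * ·) hc hc2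
    have e2 := congrArg₂ (· * ·) hc1 hc3
    linear_combination e1 - e2
  have hWφ : φ (φ W) = W := by simp only [hWdef, map_add, map_mul, hφ4]; ring
  have hDW : D * (W * σ W) = 0 := by
    refine (hfix _ ?_).resolve_right fun h => hcube W _ hWφ hDφ (by rw [hD1, h])
    simp only [map_mul]
    linear_combination σ W * hW
  have hW0 : W = 0 := by simpa [hD] using hDW
  refine ⟨v / u, ?_, by field_simp⟩
  obtain ⟨r, hr⟩ : ∃ r, r = v / u := ⟨_, rfl⟩
  have hvr : v = r * u := by rw [hr]; field_simp
  rw [← hr]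
  have hφφu : φ (φ u) ≠ 0 := by simp [hu0]
  have hrφ : φ (φ r) = r := by
    rw [hWdef, CharTwo.add_eq_zero, hvr] at hW0
    simp only [map_mul] at hW0
    exact mul_right_cancel₀ (mul_ne_zero hu0 hφφu) (by linear_combination hW0)
  have hQ : b * u + φ (φ (φ c)) * φ (φ u) ≠ 0 := by
    intro h
    have h' := congrArg φ (congrArg φ h)
    simp only [map_add, map_mul, hφ4, map_zero] at h'
    exact mul_ne_zero hD hu0 (by rw [hDdef]; grind)
  have hrσ : φ (φ (σ (σ r))) = σ (σ r) := by simp only [← hcomm, hrφ]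
  rw [hvr] at hv'
  simp only [map_mul, hrφ, hrσ] at hv'
  exact mul_right_cancel₀ hQ (by linear_combination hv' - σ (σ r) * hu')

/-- If `N(b) = N(φ(bα))`, with `N` the norm to the fixed field of `φ²`, the kernel is trivial. -/
theorem eq_zero_of_eq_zero
    (hσi : ∀ x, σ (σi x) = x)
    (hφ4 : ∀ x, φ (φ (φ (φ x))) = x) (hcomm : ∀ x, σ (φ x) = φ (σ x))
    {t : L} (ht : t ≠ 0)
    (hfifth : ∀ h ρ, h ≠ 0 → ρ ≠ 0 → φ (φ ρ) = ρ → φ t * h ≠ φ (σ h) * ρ)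
    {b c : L} (hb : b ≠ 0) (hc : c * t = b * φ t) (hD : b * φ (φ b) + φ c * φ (φ (φ c)) = 0)
    {u : L} (hu : b * σ u + φ c * φ (φ (σ u)) = σi (b * u + φ (φ (φ c)) * φ (φ u))) :
    u = 0 := by
  by_contra hu0
  have hφb : φ (φ b) ≠ 0 := by simp [hb]
  rw [CharTwo.add_eq_zero] at hD
  obtain ⟨g, hg0, hg⟩ := exists_ratio_of_involution (φ.comp φ) (β := φ c / b)
    (fun x => hφ4 x) (by
      simp only [RingHom.comp_apply, map_div₀]
      field_simp
      linear_combination -hD)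
  simp only [RingHom.comp_apply] at hg
  have hgc : φ c * g = b * φ (φ g) := by rw [hg]; field_simp
  have hgc2 := congrArg φ (congrArg φ hgc)
  simp only [map_mul, hφ4] at hgc2
  have hφg : φ (φ g) ≠ 0 := by simp [hg0]
  have hσg : σ g ≠ 0 := by simp [hg0]
  have hσb : σ b ≠ 0 := by simp [hb]
  obtain ⟨A, hA⟩ : ∃ A, A = g * σ u + φ (φ (g * σ u)) := ⟨_, rfl⟩
  obtain ⟨B, hB⟩ : ∃ B, B = b * u / g + φ (φ (b * u / g)) := ⟨_, rfl⟩
  have hAφ : φ (φ A) = A := by rw [hA]; simp only [map_add, hφ4]; ring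
  have hBφ : φ (φ B) = B := by rw [hB]; simp only [map_add, hφ4]; ring
  have hP : b * σ u + φ c * φ (φ (σ u)) = b / g * A := by
    rw [hA]; field_simp; simp only [map_mul]; linear_combination φ (φ (σ u)) * hgc
  have hQ : b * u + φ (φ (φ c)) * φ (φ u) = g * B := by
    rw [hB]; simp only [map_mul, map_div₀]; field_simp
    linear_combination φ (φ u) * hgc2
  have hAB : σ b * σ A = g * σ g * B := by
    rw [hP, hQ] at hu
    have := congrArg σ hu
    rw [hσi] at this
    simp only [map_mul, map_div₀] at this
    field_simp at this
    linear_combination this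
  -- `ρ = gσ(g)/σ(b)` is fixed by `φ²`
  obtain ⟨ρ, hρ⟩ : ∃ ρ, ρ = g * σ g / σ b := ⟨_, rfl⟩
  have hρ0 : ρ ≠ 0 := by rw [hρ]; simp [hg0, hb]
  have hρφ : φ (φ ρ) = ρ := by
    by_cases hA0 : A = 0
    · have hB0 : B = 0 := by
        have : g * σ g * B = 0 := by rw [← hAB, hA0]; simp
        simpa [hg0] using this
      have h1 : φ (φ (g * σ u)) = g * σ u := (CharTwo.add_eq_zero.1 (hA.symm.trans hA0)).symm
      have h3 : φ (φ (b * u / g)) = b * u / g := (CharTwo.add_eq_zero.1 (hB.symm.trans hB0)).symm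
      have hσu : σ u ≠ 0 := by simp [hu0]
      have h4 : ρ = g * σ u / σ (b * u / g) := by
        rw [hρ]; simp only [map_mul, map_div₀]; field_simp
      rw [h4, map_div₀, map_div₀, h1, ← hcomm, ← hcomm, h3]
    · have hσA : σ A ≠ 0 := by simp [hA0]
      have hB0 : B ≠ 0 := by
        rintro rfl
        simp [hb, hA0] at hAB
      have h4 : ρ = σ A / B := by
        rw [hρ]; field_simp; linear_combination -hAB
      rw [h4, map_div₀, map_div₀, hBφ, ← hcomm, ← hcomm, hAφ]
  obtain ⟨h, hh⟩ : ∃ h, h = σi g := ⟨_, rfl⟩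
  obtain ⟨κ, hκ⟩ : ∃ κ, κ = σi ρ := ⟨_, rfl⟩
  have hgh : g = σ h := by rw [hh, hσi]
  have hρκ : ρ = σ κ := by rw [hκ, hσi]
  have hh0 : h ≠ 0 := by rintro rfl; simp [hgh] at hg0
  have hκ0 : κ ≠ 0 := by rintro rfl; simp [hρκ] at hρ0
  have hκφ : φ (φ κ) = κ := by
    apply σ.injective
    rw [hcomm, hcomm, ← hρκ, hρφ]
  have hbκ : b * κ = h * σ h := by
    apply σ.injective
    rw [map_mul, ← hρκ, hρ, map_mul, ← hgh]
    field_simp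
  -- `z = φ(t) h / (φ(σ h) κ)` is fixed by `φ`
  obtain ⟨z, hz⟩ : ∃ z, z = φ t * h / (φ (σ h) * κ) := ⟨_, rfl⟩
  have hσh : σ h ≠ 0 := by simp [hh0]
  have hφσh : φ (σ h) ≠ 0 := by simp [hh0]
  have hφκ : φ κ ≠ 0 := by simp [hκ0]
  have hz0 : z ≠ 0 := by rw [hz]; simp [ht, hh0, hκ0]
  have hzφ : φ z = z := by
    have hc1 := congrArg φ hc
    have hb1 := congrArg φ hbκ
    simp only [map_mul] at hc1 hb1
    rw [hz]; simp only [map_mul, map_div₀]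
    rw [div_eq_div_iff (by simp [hh0, hκ0]) (by simp [hh0, hκ0])]
    rw [hgh] at hgc
    refine mul_right_cancel₀ (mul_ne_zero (mul_ne_zero hb hσh) hφκ) ?_
    have e : φ b * φ (φ t) * σ h = b * φ (φ (σ h)) * φ t := by
      linear_combination φ t * hgc - σ h * hc1
    linear_combination (-φ (φ t) * b * κ * σ h * φ κ) * hb1 +
      b * κ * (φ κ) ^ 2 * e + b * φ (φ (σ h)) * φ t * (φ κ) ^ 2 * hbκ
  refine hfifth h (κ * z) hh0 (mul_ne_zero hκ0 hz0) (by simp [hκφ, hzφ]) ?_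
  rw [hz]; field_simp

end Kernel

/-- Exponents of the Frobenius of a field with `2 ^ m` elements may be read modulo `m`. -/
theorem pow_two_pow_mul_add {L : Type*} [Field L] [Fintype L] {m : ℕ}
    (hcard : Fintype.card L = 2 ^ m) (q j : ℕ) (x : L) :
    x ^ 2 ^ (m * q + j) = x ^ 2 ^ j := by
  have h : ∀ y : L, y ^ 2 ^ (m * q) = y := fun y => by
    rw [pow_mul, ← hcard, FiniteField.pow_card_pow]
  rw [pow_add, pow_mul, h]

/-- An element of a field with `2 ^ m` elements fixed by the `j`-th power of Frobenius is fixed by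
the `gcd j m`-th power. -/
theorem pow_two_pow_gcd {L : Type*} [Field L] [Fintype L] {m : ℕ}
    (hcard : Fintype.card L = 2 ^ m) {j : ℕ} {x : L} (hx : x ^ 2 ^ j = x) :
    x ^ 2 ^ Nat.gcd j m = x := by
  have hit : ∀ i, (fun y : L => y ^ 2)^[i] x = x ^ 2 ^ i := fun i => by
    rw [pow_iterate]
  have h1 : Function.IsPeriodicPt (fun y : L => y ^ 2) j x := (hit j).trans hx
  have h2 : Function.IsPeriodicPt (fun y : L => y ^ 2) m x :=
    (hit m).trans (by rw [← hcard, FiniteField.pow_card])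
  exact (hit _).symm.trans (h1.gcd h2)

/-- If the powers of `t` exhaust the nonzero elements, `t` has no smaller period. -/
theorem pow_ne_one_of_forall_eq_pow {L : Type*} [Field L] [Fintype L] {t : L}
    (ht : ∀ y : L, y ≠ 0 → ∃ j : ℕ, y = t ^ j) {e : ℕ} (he0 : 0 < e)
    (he : e < Fintype.card L - 1) : t ^ e ≠ 1 := by
  classical
  intro h
  have hsub : (Finset.univ.erase (0 : L)) ⊆ (Finset.range e).image (t ^ ·) := by
    intro y hy
    obtain ⟨j, rfl⟩ := ht y (Finset.ne_of_mem_erase hy)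
    exact Finset.mem_image.2 ⟨j % e, Finset.mem_range.2 (Nat.mod_lt _ he0),
      (pow_eq_pow_mod j h).symm⟩
  have h1 := (Finset.card_le_card hsub).trans Finset.card_image_le
  rw [Finset.card_erase_of_mem (Finset.mem_univ _), Finset.card_univ, Finset.card_range] at h1
  omega

/-- The cubic obstruction: `N(t)` is not a cube in the subfield with `2 ^ (2 * k)` elements. -/
theorem norm_mul_ne_one {L : Type*} [Field L] [Fintype L] {k s : ℕ} (hk : 0 < k)
    (hkodd : Odd k) (hs : Odd s) (hcard : Fintype.card L = 2 ^ (4 * k))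
    {t : L} (ht : ∀ y : L, y ≠ 0 → ∃ j : ℕ, y = t ^ j)
    {W d : L} (hW : W ^ 2 ^ (2 * k) = W) (hd : d ^ 2 ^ k = d) :
    t * t ^ 2 ^ (2 * k) * d * (W * W ^ 2 ^ s) ≠ 1 := by
  intro h
  have hW0 : W ≠ 0 := by rintro rfl; simp at h
  have hd0 : d ≠ 0 := by rintro rfl; simp at h
  have hWe : W ^ (2 ^ (2 * k) - 1) = 1 := by
    rw [pow_sub₀ _ hW0 Nat.one_le_two_pow, hW, pow_one, mul_inv_cancel₀ hW0]
  have hde : d ^ (2 ^ k - 1) = 1 := by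
    rw [pow_sub₀ _ hd0 Nat.one_le_two_pow, hd, pow_one, mul_inv_cancel₀ hd0]
  obtain ⟨a, ha⟩ : 3 ∣ 2 ^ s + 1 := by simpa using hs.nat_add_dvd_pow_add_pow 2 1
  obtain ⟨c, hc⟩ : 3 ∣ 2 ^ k + 1 := by simpa using hkodd.nat_add_dvd_pow_add_pow 2 1
  obtain ⟨q, hq⟩ : ∃ q, 2 ^ k = q + 1 := ⟨2 ^ k - 1, by have := Nat.one_le_two_pow (n := k); omega⟩
  have hq0 : 0 < q := by
    have := Nat.one_lt_two_pow hk.ne'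
    omega
  have hc0 : 0 < c := by omega
  have hqq : 2 ^ (2 * k) = 3 * (q * c) + 1 := by
    rw [mul_comm, pow_mul, hq]
    rw [hq] at hc
    nlinarith
  have hqqq : 2 ^ (4 * k) = 3 * ((1 + 2 ^ (2 * k)) * (q * c)) + 1 := by
    rw [show 4 * k = 2 * k * 2 by ring, pow_mul, hqq]
    ring
  rw [hq, Nat.add_sub_cancel] at hde
  rw [hqq, Nat.add_sub_cancel] at hWe
  have hpow := congrArg (· ^ (q * c)) h
  simp only [one_pow, mul_pow] at hpow
  have h1 : d ^ (q * c) = 1 := by rw [pow_mul, hde, one_pow]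
  have h2 : W ^ (q * c) * (W ^ 2 ^ s) ^ (q * c) = 1 := by
    rw [← mul_pow, ← pow_succ', ha, ← pow_mul, show 3 * a * (q * c) = 3 * (q * c) * a by ring,
      pow_mul, hWe, one_pow]
  rw [h1, h2, mul_one, mul_one, ← mul_pow, ← pow_succ', ← pow_mul, add_comm (2 ^ (2 * k)) 1] at hpow
  have hpos : 0 < (1 + 2 ^ (2 * k)) * (q * c) := by positivity
  exact pow_ne_one_of_forall_eq_pow ht hpos (by omega) hpow

/-- The quintic obstruction: `t` is not a fifth power times an element of the subfield with
`2 ^ (2 * k)` elements. -/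
theorem conj_mul_ne {L : Type*} [Field L] [Fintype L] {k j : ℕ} (hk : 0 < k)
    (hkodd : Odd k) (hj : 4 ∣ j) (hcard : Fintype.card L = 2 ^ (4 * k))
    {t : L} (ht : ∀ y : L, y ≠ 0 → ∃ j : ℕ, y = t ^ j)
    {h ρ : L} (hh : h ≠ 0) (hρ0 : ρ ≠ 0) (hρ : ρ ^ 2 ^ (2 * k) = ρ) :
    t ^ 2 ^ k * h ≠ h ^ 2 ^ j * ρ := by
  intro heq
  have hρe : ρ ^ (2 ^ (2 * k) - 1) = 1 := by
    rw [pow_sub₀ _ hρ0 Nat.one_le_two_pow, hρ, pow_one, mul_inv_cancel₀ hρ0]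
  obtain ⟨a, ha⟩ : 5 ∣ 2 ^ (2 * k) + 1 := by
    have h5 := hkodd.nat_add_dvd_pow_add_pow (2 ^ 2) 1
    rwa [one_pow, ← pow_mul] at h5
  obtain ⟨c, hc⟩ : 5 ∣ 2 ^ j - 1 := by
    obtain ⟨i, rfl⟩ := hj
    have h15 := Nat.sub_dvd_pow_sub_pow (2 ^ 4) 1 i
    rw [one_pow] at h15
    rw [pow_mul]
    exact (by norm_num : 5 ∣ 2 ^ 4 - 1).trans h15
  have hj1 := Nat.one_le_two_pow (n := j)
  obtain ⟨q, hq⟩ : ∃ q, 2 ^ (2 * k) = q + 1 :=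
    ⟨2 ^ (2 * k) - 1, by have := Nat.one_le_two_pow (n := 2 * k); omega⟩
  have hq0 : 0 < q := by
    have := Nat.one_lt_two_pow (n := 2 * k) (by omega)
    omega
  have ha0 : 0 < a := by omega
  rw [hq, Nat.add_sub_cancel] at hρe
  have hqq : 2 ^ (4 * k) = 5 * (q * a) + 1 := by
    rw [show 4 * k = 2 * k * 2 by ring, pow_mul, hq]
    rw [hq] at ha
    nlinarith
  have heq' : t ^ 2 ^ k = h ^ (5 * c) * ρ := by
    refine mul_right_cancel₀ hh ?_
    rw [heq, show 2 ^ j = 5 * c + 1 by omega]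
    ring
  have hcyc : ∀ y : L, y ≠ 0 → y ^ (5 * (q * a)) = 1 := fun y hy => by
    have := FiniteField.pow_card_sub_one_eq_one y hy
    rwa [hcard, hqq, Nat.add_sub_cancel] at this
  have hpow := congrArg (· ^ (q * a)) heq'
  simp only [mul_pow] at hpow
  rw [pow_mul ρ, hρe, one_pow, mul_one, ← pow_mul h, show 5 * c * (q * a) = 5 * (q * a) * c by ring,
    pow_mul h, hcyc h hh, one_pow, ← pow_mul, mul_comm, pow_mul] at hpow
  have h1 : (t ^ (q * a)) ^ 2 ^ (4 * k) = 1 := by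
    rw [show 4 * k = k + 3 * k by ring, pow_add, pow_mul, hpow, one_pow]
  rw [← hcard, FiniteField.pow_card] at h1
  have hpos : 0 < q * a := by positivity
  exact pow_ne_one_of_forall_eq_pow ht hpos (by omega) h1

/-- Let `n = 4k` with `k ≥ 3` odd, and let `s` satisfy `gcd(s,2k) = 1` and
`sk ≡ -1 (mod 4)`.  Let `t` be a primitive element of `L = GF(2^n)` and
`α = t^{2^k-1}`.  Then for every `b ∈ L^*`, the equation
`L_b(u) = b u^{2^s} + (bu)^{2^{-s}} + (bα)^{2^k} u^{2^{2k+s}} + (bα)^{2^{-k-s}} u^{2^{2k-s}} = 0`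
has at most 4 solutions `u ∈ L`.
(A Frobenius index `-j` is rendered by the representative `n - j % n`, which agrees
with it modulo `n`, hence modulo `2^n - 1` on exponents.) -/
theorem stmt11 (k s : ℕ) (hk : 3 ≤ k) (hkodd : Odd k)
    (hgcd : Nat.gcd s (2 * k) = 1) (hsk : (s * k) % 4 = 3)
    (L : Type*) [Field L] [Fintype L] (hcard : Fintype.card L = 2 ^ (4 * k))
    (t : L) (ht : ∀ y : L, y ≠ 0 → ∃ j : ℕ, y = t ^ j)
    (α : L) (hα : α = t ^ (2 ^ k - 1))
    (b : L) (hb : b ≠ 0) :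
    {u : L |
        b * u ^ (2 ^ s) + (b * u) ^ (2 ^ (4 * k - s % (4 * k)))
          + (b * α) ^ (2 ^ k) * u ^ (2 ^ (2 * k + s))
          + (b * α) ^ (2 ^ (3 * k + (4 * k - s % (4 * k))))
            * u ^ (2 ^ (2 * k + (4 * k - s % (4 * k)))) = 0}.ncard ≤ 4 := by
  classical
  have hchar : CharP L 2 := by
    obtain ⟨p, hpchar⟩ := CharP.exists L
    have hpp : p.Prime := CharP.char_is_prime L p
    have hdvd : p ∣ 2 ^ (4 * k) := by
      rw [← hcard, ← CharP.cast_eq_zero_iff L p, FiniteField.cast_card_eq_zero]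
    rwa [(Nat.prime_dvd_prime_iff_eq hpp Nat.prime_two).1 (hpp.dvd_of_dvd_pow hdvd)] at hpchar
  have hs2 : Nat.Coprime s 2 := Nat.Coprime.coprime_dvd_right (Dvd.intro _ rfl) hgcd
  have hsodd : Odd s := Nat.coprime_two_right.1 hs2
  have hs4 : Nat.gcd s (4 * k) = 1 := by
    rw [show 4 * k = 2 * (2 * k) by ring]
    exact Nat.Coprime.mul_right hs2 hgcd
  have hs4' : Nat.gcd (2 * s) (4 * k) = 2 := by
    rw [show 4 * k = 2 * (2 * k) by ring, Nat.gcd_mul_left, hgcd]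
  have hdvd4 : 4 ∣ s + k := by
    have h1 : s % 4 < 4 := Nat.mod_lt _ (by norm_num)
    have h2 : k % 4 < 4 := Nat.mod_lt _ (by norm_num)
    rw [Nat.mul_mod] at hsk
    generalize hx : s % 4 = x at *
    generalize hy : k % 4 = y at *
    interval_cases x <;> interval_cases y <;> omega
  have hmod : s % (4 * k) < 4 * k := Nat.mod_lt _ (by omega)
  have hdm := Nat.div_add_mod s (4 * k)
  generalize hr : 4 * k - s % (4 * k) = r
  have hsr : s + r = 4 * k * (s / (4 * k) + 1) + 0 := by rw [mul_add]; omega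
  have hred := pow_two_pow_mul_add hcard
  have ht0 : t ≠ 0 := by
    rintro rfl
    have hmem : ∀ y : L, y = 0 ∨ y = 1 := fun y => by
      by_cases hy : y = 0
      · exact Or.inl hy
      · obtain ⟨j, rfl⟩ := ht y hy
        exact Or.inr (by rcases j with _ | j <;> simp_all)
    have hle : Fintype.card L ≤ 2 := by
      rw [← Finset.card_univ]
      refine (Finset.card_le_card (t := {0, 1}) fun y _ => ?_).trans Finset.card_le_two
      simpa using hmem y
    have := Nat.pow_le_pow_right (n := 2) two_pos (show 2 ≤ 4 * k by omega)
    omega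
  obtain ⟨σ, hσ⟩ : ∃ σ : L →+* L, ∀ x, σ x = x ^ 2 ^ s :=
    ⟨iterateFrobenius L 2 s, fun x => iterateFrobenius_def 2 s x⟩
  obtain ⟨σi, hσi⟩ : ∃ σi : L →+* L, ∀ x, σi x = x ^ 2 ^ r :=
    ⟨iterateFrobenius L 2 r, fun x => iterateFrobenius_def 2 r x⟩
  obtain ⟨φ, hφ⟩ : ∃ φ : L →+* L, ∀ x, φ x = x ^ 2 ^ k :=
    ⟨iterateFrobenius L 2 k, fun x => iterateFrobenius_def 2 k x⟩
  have hφ2 : ∀ x, φ (φ x) = x ^ 2 ^ (2 * k) := fun x => by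
    rw [hφ, hφ, ← pow_mul, ← pow_add, two_mul]
  have hφ4 : ∀ x, φ (φ (φ (φ x))) = x := fun x => by
    rw [hφ2, hφ2, ← pow_mul, ← pow_add, show 2 * k + 2 * k = 4 * k * 1 + 0 by ring, hred]
    simp
  have hσσi : ∀ x, σ (σi x) = x := fun x => by
    rw [hσ, hσi, ← pow_mul, ← pow_add, add_comm r, hsr, hred]
    simp
  have hcomm : ∀ x, σ (φ x) = φ (σ x) := fun x => by
    rw [hσ, hφ, hφ, hσ, ← pow_mul, ← pow_mul, mul_comm]
  have hfix : ∀ x, σ x = x → x = 0 ∨ x = 1 := fun x hx => by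
    have h := pow_two_pow_gcd hcard ((hσ x).symm.trans hx)
    rw [hs4] at h
    exact IsIdempotentElem.iff_eq_zero_or_one.1 ((pow_two x).symm.trans (by simpa using h))
  have hcube : ∀ W d, φ (φ W) = W → φ d = d → t * φ (φ t) * d * (W * σ W) ≠ 1 := by
    intro W d hW hd
    rw [hφ2] at hW ⊢
    rw [hφ] at hd
    rw [hσ]
    exact norm_mul_ne_one (by omega) hkodd hsodd hcard ht hW hd
  have hfifth : ∀ h ρ, h ≠ 0 → ρ ≠ 0 → φ (φ ρ) = ρ → φ t * h ≠ φ (σ h) * ρ := by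
    intro h ρ hh hρ0 hρ
    rw [hφ2] at hρ
    rw [hφ, hφ, hσ, ← pow_mul, ← pow_add]
    exact conj_mul_ne (by omega) hkodd hdvd4 hcard ht hh hρ0 hρ
  have hc : b * α * t = b * φ t := by
    rw [mul_assoc, hα, ← pow_succ, Nat.sub_add_cancel Nat.one_le_two_pow, hφ]
  generalize b * α = c at hc ⊢
  set R : Set L := {x | σ (σ x) = x} with hRdef
  have hR4 : R.ncard ≤ 4 := by
    have hne : (Polynomial.X ^ 4 - Polynomial.X : Polynomial L) ≠ 0 :=
      FiniteField.X_pow_card_sub_X_ne_zero L (by norm_num)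
    have hsub : R ⊆ ((Polynomial.X ^ 4 - Polynomial.X : Polynomial L).roots.toFinset : Set L) := by
      intro x hx
      have h : x ^ 2 ^ (2 * s) = x := by
        have h' : σ (σ x) = x := hx
        rwa [hσ, hσ, ← pow_mul, ← pow_add, ← two_mul] at h'
      have h' := pow_two_pow_gcd hcard h
      rw [hs4'] at h'
      simp [hne, Polynomial.IsRoot, show x ^ 4 = x from h']
    calc R.ncard ≤ _ := Set.ncard_le_ncard hsub (Set.toFinite _)
      _ = _ := Set.ncard_coe_finset _
      _ ≤ _ := Multiset.toFinset_card_le _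
      _ ≤ _ := Polynomial.card_roots' _
      _ = 4 := FiniteField.X_pow_card_sub_X_natDegree_eq L (by norm_num)
  have hR1 : 1 ≤ R.ncard := (Set.ncard_pos (Set.toFinite _)).2 ⟨0, by simp [hRdef]⟩
  refine (ncard_le_of_ratio_mem hR1 ?_).trans hR4
  have hker : ∀ u : L, b * u ^ 2 ^ s + (b * u) ^ 2 ^ r + c ^ 2 ^ k * u ^ 2 ^ (2 * k + s)
      + c ^ 2 ^ (3 * k + r) * u ^ 2 ^ (2 * k + r) = 0 →
      b * σ u + φ c * φ (φ (σ u)) = σi (b * u + φ (φ (φ c)) * φ (φ u)) := by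
    intro u hu
    have e1 : u ^ 2 ^ (2 * k + s) = φ (φ (σ u)) := by
      rw [hφ2, hσ, ← pow_mul, ← pow_add, add_comm]
    have e2 : u ^ 2 ^ (2 * k + r) = σi (φ (φ u)) := by
      rw [hφ2, hσi, ← pow_mul, ← pow_add]
    have e3 : c ^ 2 ^ (3 * k + r) = σi (φ (φ (φ c))) := by
      rw [hφ2, hφ, hσi, ← pow_mul, ← pow_mul, ← pow_add, ← pow_add]
      congr 2; ring
    rw [e1, e2, e3, ← hσ, ← hσi, ← hφ] at hu
    rw [← CharTwo.add_eq_zero, map_add, map_mul σi (φ (φ (φ c)))]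
    linear_combination hu
  intro u hu hu0 v hv
  have hu := hker u hu
  have hv := hker v hv
  by_cases hD : b * φ (φ b) + φ c * φ (φ (φ c)) = 0
  · exact absurd (eq_zero_of_eq_zero σ σi φ hσσi hφ4 hcomm ht0 hfifth hb hc hD hu) hu0
  · exact ratio_fixed_of_ne_zero σ σi φ hσσi hφ4 hcomm hfix ht0 hcube hc hD hu0 hu hv
end

section
/- Let n = 4k with k odd, let s be odd, let t be a primitive element of L = GF(2^n) and α = t^{2^k−1}. For b ∈ L*, set d = b^{2^{2k−s}+2^{−s}} + (bα)^{2^{k−s}+2^{−k−s}}. If d ≠ 0, then d^{2^s−1} is not a cube in L, i.e., there is no x ∈ L with x^3 = d^{2^s−1}. -/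
/-- A generator of the multiplicative group of a finite field of cardinality `≡ 1 [MOD 3]`
is not a cube. -/
theorem pow_three_ne_of_forall_eq_pow {F : Type*} [Field F] [Fintype F]
    (hcard : 3 ∣ Fintype.card F - 1) {t : F} (ht : ∀ y : F, y ≠ 0 → ∃ j : ℕ, y = t ^ j)
    (z : F) : z ^ 3 ≠ t := by
  classical
  intro hz
  have hsurj : Function.Surjective fun y : F => y ^ 3 := by
    intro y
    by_cases hy : y = 0
    · exact ⟨0, by simp [hy]⟩
    · obtain ⟨j, rfl⟩ := ht y hy
      exact ⟨z ^ j, by simp only [← hz, ← pow_mul, mul_comm]⟩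
  have hinj := Finite.injective_iff_surjective.mpr hsurj
  have : Fact (Nat.Prime 3) := ⟨Nat.prime_three⟩
  rw [← Fintype.card_units] at hcard
  obtain ⟨g, hg⟩ := exists_prime_orderOf_dvd_card 3 hcard
  have hg3 : (g : F) ^ 3 = 1 ^ 3 := by
    rw [one_pow, ← Units.val_pow_eq_pow_val, ← hg, pow_orderOf_eq_one, Units.val_one]
  have hg1 : g = 1 := Units.ext (hinj hg3)
  simp [hg1] at hg

/-- A factor whose exponent is `≡ 1 [MOD 3]` in a cube is itself a cube. -/
theorem exists_pow_three_eq_of_pow {F : Type*} [Field F] {a x : F} {e : ℕ} (ha : a ≠ 0)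
    (he : e % 3 = 1) (hx : x ^ 3 = a ^ e) : ∃ y : F, y ^ 3 = a := by
  refine ⟨x / a ^ (e / 3), ?_⟩
  have h : e = e / 3 * 3 + 1 := by omega
  rw [div_pow, hx, div_eq_iff (by positivity), ← pow_mul, ← pow_succ', ← h]

theorem two_pow_mod_three_of_odd {m : ℕ} (hm : Odd m) : 2 ^ m % 3 = 2 := by
  obtain ⟨r, rfl⟩ := hm
  rw [pow_succ, pow_mul, Nat.mul_mod, Nat.pow_mod]
  norm_num


/-- Let `n = 4k` with `k` odd, let `s` be odd, let `t` be a primitive element of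
`L = GF(2^n)` and `α = t^{2^k-1}`.  For `b ∈ L^*`, set
`d = b^{2^{2k-s}+2^{-s}} + (bα)^{2^{k-s}+2^{-k-s}}`.  If `d ≠ 0`, then `d^{2^s-1}`
is not a cube in `L`, i.e. there is no `x ∈ L` with `x³ = d^{2^s-1}`.
(A Frobenius index `-j` is rendered by the representative `n - j % n`, which agrees
with it modulo `n`, hence modulo `2^n - 1` on exponents.) -/
theorem stmt12 (k s : ℕ) (hkodd : Odd k) (hsodd : Odd s)
    (L : Type*) [Field L] [Fintype L] (hcard : Fintype.card L = 2 ^ (4 * k))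
    (t : L) (ht : ∀ y : L, y ≠ 0 → ∃ j : ℕ, y = t ^ j)
    (α : L) (hα : α = t ^ (2 ^ k - 1))
    (b : L) (hb : b ≠ 0)
    (d : L)
    (hd : d = b ^ (2 ^ (2 * k + (4 * k - s % (4 * k))) + 2 ^ (4 * k - s % (4 * k)))
        + (b * α) ^ (2 ^ (k + (4 * k - s % (4 * k))) + 2 ^ (3 * k + (4 * k - s % (4 * k)))))
    (hdne : d ≠ 0) :
    ¬ ∃ x : L, x ^ 3 = d ^ (2 ^ s - 1) := by
  rintro ⟨x, hx⟩
  have hk : 0 < k := hkodd.pos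
  have htwo : (2 ^ s - 1) % 3 = 1 := by
    have := two_pow_mod_three_of_odd hsodd
    have := Nat.two_pow_pos s
    omega
  obtain ⟨y, hy⟩ := exists_pow_three_eq_of_pow hdne htwo hx
  have hcard3 : 3 ∣ Fintype.card L - 1 := by
    have : 2 ^ (4 * k) % 3 = 1 := by
      rw [pow_mul, Nat.pow_mod]
      norm_num
    omega
  have hncube := pow_three_ne_of_forall_eq_pow hcard3 ht
  have ht0 : t ≠ 0 := fun h => hncube 0 (by simp [h])
  have : CharP L 2 := charP_of_card_eq_prime_pow hcard
  obtain ⟨m, hm⟩ : ∃ m, 4 * k - s % (4 * k) + s = 4 * k * m := by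
    refine ⟨s / (4 * k) + 1, ?_⟩
    have h1 := Nat.mod_lt s (show 0 < 4 * k by omega)
    have h2 := Nat.div_add_mod s (4 * k)
    rw [mul_add, mul_one]
    omega
  set e := 4 * k - s % (4 * k) with he
  have hfrob (a : L) : a ^ 2 ^ (e + s) = a := by
    rw [hm, pow_mul, ← hcard, FiniteField.pow_card_pow]
  have hfrob' (a : L) (i : ℕ) : (a ^ 2 ^ (i + e)) ^ 2 ^ s = a ^ 2 ^ i := by
    rw [← pow_mul, ← pow_add, add_assoc, pow_add, pow_mul, hfrob]
  set q := 2 ^ k with hq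
  have hq3 : q % 3 = 2 := two_pow_mod_three_of_odd hkodd
  have hq0 : 0 < q := Nat.two_pow_pos k
  have hpow (i : ℕ) : 2 ^ (i * k) = q ^ i := by rw [hq, ← pow_mul, mul_comm]
  have hq4 (a : L) : a ^ q ^ 4 = a := by
    rw [← hpow, ← hcard, FiniteField.pow_card]
  have hD : d ^ 2 ^ s = b ^ q ^ 2 * b + (b * α) ^ q * (b * α) ^ q ^ 3 := by
    have h0 := hfrob' b 0
    rw [zero_add, pow_zero, pow_one] at h0
    rw [hd, add_pow_char_pow, pow_add b, pow_add (b * α), mul_pow, mul_pow, h0, hfrob', hfrob',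
      hfrob', hpow, hpow]
  have hα' : α * t = t ^ q := by
    rw [hα, ← pow_succ, Nat.sub_add_cancel (by omega)]
  have hα1 : α ^ q * t ^ q = t ^ q ^ 2 := by
    rw [← mul_pow, hα', ← pow_mul, sq]
  have hα3 : α ^ q ^ 3 * t ^ q ^ 3 = t := by
    rw [← mul_pow, hα', ← pow_mul, ← pow_succ', hq4]
  set c := d ^ 2 ^ s * (t ^ q * t ^ q ^ 3) with hc
  have hc0 : c ≠ 0 := by positivity
  have hcsymm : c = b * b ^ q ^ 2 * (t ^ q * t ^ q ^ 3) + b ^ q * b ^ q ^ 3 * (t * t ^ q ^ 2) := by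
    rw [hc, hD, mul_pow, mul_pow]
    linear_combination (b ^ q * b ^ q ^ 3) * (α ^ q ^ 3 * t ^ q ^ 3) * hα1 +
      (b ^ q * b ^ q ^ 3) * t ^ q ^ 2 * hα3
  have hcq : c ^ q = c := by
    have hstep (a : L) (i : ℕ) : (a ^ q ^ i) ^ q = a ^ q ^ (i + 1) := by
      rw [← pow_mul, ← pow_succ]
    have hadd (a a' : L) : (a + a') ^ q = a ^ q + a' ^ q := add_pow_char_pow ..
    have hsq (a : L) : (a ^ q) ^ q = a ^ q ^ 2 := by rw [← pow_mul, sq]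
    rw [hcsymm, hadd]
    simp only [mul_pow, hstep, hsq, Nat.reduceAdd, hq4]
    ring
  obtain ⟨r, hr⟩ : ∃ r, r ^ 3 = c := by
    refine exists_pow_three_eq_of_pow (x := 1) (e := q - 1) hc0 (by omega) ?_
    rw [one_pow]
    refine mul_right_cancel₀ hc0 ?_
    rw [← pow_succ, Nat.sub_add_cancel (by omega), hcq, one_mul]
  have hexp : (q + q ^ 3) % 3 = 1 := by
    simp [Nat.add_mod, Nat.pow_mod, hq3]
  obtain ⟨z, hz⟩ := exists_pow_three_eq_of_pow (x := r / y ^ 2 ^ s) ht0 hexp (by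
    rw [div_pow, hr, ← pow_mul, mul_comm, pow_mul, hy, hc, pow_add,
      mul_div_cancel_left₀ _ (pow_ne_zero _ hdne)])
  exact hncube z hz
end
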